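/- arXiv:1507.08080 — 2 statements merged into one kernel-verified Lean document; each statement's English description precedes it below -/
import Mathlib

section
/- Let n ≥ 5 and let P₀ : Fin n → ℝ² be a configuration of n labeled points (injective, in general position). Then the set of chirotope functions { χ_Q | Q : Fin n → ℝ² injective, in general position, and Q has the same radial system as P₀ } has at most n − 1 elements. -/
noncomputable def det2 (v w : ℝ × ℝ) : ℝ := v.1 * w.2 - v.2 * w.1

noncomputable def chi {α : Type*} (P : α → ℝ × ℝ) (i j k : α) : ℝ :=
  Real.sign (det2 (P j - P i) (P k - P i))

def GenPos {α : Type*} (P : α → ℝ × ℝ) : Prop :=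
  ∀ i j k : α, i ≠ j → i ≠ k → j ≠ k → chi P i j k ≠ 0

def Ccw {α : Type*} (P : α → ℝ × ℝ) (i j k l : α) : Prop :=
  (chi P i j k = 1 ∧ chi P i k l = 1) ∨
  (chi P i k l = 1 ∧ chi P i l j = 1) ∨
  (chi P i l j = 1 ∧ chi P i j k = 1)

def Admissible {α : Type*} (i j k l : α) : Prop :=
  i ≠ j ∧ i ≠ k ∧ i ≠ l ∧ j ≠ k ∧ j ≠ l ∧ k ≠ l

def SameRadial {α : Type*} (P Q : α → ℝ × ℝ) : Prop :=
  ∀ i j k l : α, Admissible i j k l → (Ccw P i j k l ↔ Ccw Q i j k l)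

def SameUndirected {α : Type*} (P Q : α → ℝ × ℝ) : Prop :=
  ∀ i : α, (∀ j k l : α, Admissible i j k l → (Ccw Q i j k l ↔ Ccw P i j k l)) ∨
           (∀ j k l : α, Admissible i j k l → (Ccw Q i j k l ↔ Ccw P i l k j))

def ExtremeSet {α : Type*} (P : α → ℝ × ℝ) : Set α :=
  {i | P i ∉ convexHull ℝ (P '' {j | j ≠ i})}

def Important {n : ℕ} (P₀ : Fin n → ℝ × ℝ) (H : Set (Fin n)) : Prop :=
  ∃ Q : Fin n → ℝ × ℝ, Function.Injective Q ∧ GenPos Q ∧ SameRadial P₀ Q ∧ ExtremeSet Q = H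

def lineThrough (p q : ℝ × ℝ) : Set (ℝ × ℝ) := {x | ∃ t : ℝ, x = p + t • (q - p)}

/-- The combinatorial properties of the relation of being a counterclockwise triple. -/
structure IsOrientation {α : Type*} (t : α → α → α → Prop) : Prop where
  cyc : ∀ i j k, t i j k ↔ t j k i
  anti : ∀ i j k, i ≠ j → i ≠ k → j ≠ k → (t i k j ↔ ¬ t i j k)
  inner : ∀ i j k l, t i j l → t j k l → t k i l → t i j k
  surround : ∀ i j k x y, t i j x → t j k x → t k i x → ¬ (t x y i ∧ t x y j ∧ t x y k)

/-- The majority of three propositions. -/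
def Majority (p q r : Prop) : Prop := (p ∧ q) ∨ (q ∧ r) ∨ (r ∧ p)

/-- Two orientation relations have the same radial orderings. -/
def RadialEq {α : Type*} (s t : α → α → α → Prop) : Prop :=
  ∀ i j k l, Admissible i j k l →
    (Majority (s i j k) (s i k l) (s i l j) ↔ Majority (t i j k) (t i k l) (t i l j))

section FourPoints

variable {α : Type*} {s t : α → α → α → Prop} {i j k l : α}

lemma IsOrientation.not_of_inner (hs : IsOrientation s) (hd : Admissible i j k l) :
    ¬ (s i j l ∧ s j k l ∧ ¬ s i k l ∧ ¬ s i j k) ∧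
    ¬ (¬ s i j l ∧ ¬ s j k l ∧ s i k l ∧ s i j k) := by
  obtain ⟨hij, hik, hil, hjk, hjl, hkl⟩ := hd
  have h1 := hs.inner i j k l
  have h2 := hs.inner j i k l
  rw [hs.cyc k i l, hs.anti i k l hik hil hkl] at h1
  rw [hs.cyc j i l, hs.anti i j l hij hil hjl, hs.cyc k j l, hs.anti j k l hjk hjl hkl,
    hs.cyc j i k, hs.anti i j k hij hik hjk] at h2
  tauto

/-- The radial relations at the four points, in terms of the four increasing triples. -/
lemma RadialEq.majorities (h : RadialEq s t) (hs : IsOrientation s) (ht : IsOrientation t)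
    (hd : Admissible i j k l) :
    (Majority (s i j k) (s i k l) (¬ s i j l) ↔ Majority (t i j k) (t i k l) (¬ t i j l)) ∧
    (Majority (¬ s i j k) (s j k l) (s i j l) ↔ Majority (¬ t i j k) (t j k l) (t i j l)) ∧
    (Majority (s i j k) (¬ s j k l) (s i k l) ↔ Majority (t i j k) (¬ t j k l) (t i k l)) ∧
    (Majority (s i j l) (s j k l) (¬ s i k l) ↔ Majority (t i j l) (t j k l) (¬ t i k l)) := by
  obtain ⟨hij, hik, hil, hjk, hjl, hkl⟩ := hd
  have h1 := h i j k l ⟨hij, hik, hil, hjk, hjl, hkl⟩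
  have h2 := h j i k l ⟨hij.symm, hjk, hjl, hik, hil, hkl⟩
  have h3 := h k i j l ⟨hik.symm, hjk.symm, hkl, hij, hil, hjl⟩
  have h4 := h l i j k ⟨hil.symm, hjl.symm, hkl.symm, hij, hik, hjk⟩
  have key : ∀ {u : α → α → α → Prop}, IsOrientation u →
      (u i l j ↔ ¬ u i j l) ∧ (u j i k ↔ ¬ u i j k) ∧ (u j l i ↔ u i j l) ∧ (u k i j ↔ u i j k) ∧
      (u k j l ↔ ¬ u j k l) ∧ (u k l i ↔ u i k l) ∧ (u l i j ↔ u i j l) ∧ (u l j k ↔ u j k l) ∧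
      (u l k i ↔ ¬ u i k l) := by
    intro u hu
    have a1 := hu.anti i j l hij hil hjl
    have a2 := hu.anti i j k hij hik hjk
    have a3 := hu.anti i k l hik hil hkl
    have a4 := hu.anti j k l hjk hjl hkl
    have c := hu.cyc
    refine ⟨a1, ?_, (c i j l).symm, c k i j, ?_, (c i k l).symm, c l i j, c l j k, ?_⟩
    · rw [c, a2]
    · rw [c, a4]
    · rw [← c i l k, a3]
  obtain ⟨s1, s2, s3, s4, s5, s6, s7, s8, s9⟩ := key hs
  obtain ⟨t1, t2, t3, t4, t5, t6, t7, t8, t9⟩ := key ht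
  rw [s1, t1] at h1
  rw [s2, t2, s3, t3] at h2
  rw [s4, t4, s5, t5, s6, t6] at h3
  rw [s7, t7, s8, t8, s9, t9] at h4
  exact ⟨h1, h2, h3, h4⟩

/-- Radially equivalent orientations of four points agree, or differ in exactly two triples by
exchanging the interior point with another one. Here the signs are those of the affine dependency
of the four points. -/
lemma RadialEq.four (h : RadialEq s t) (hs : IsOrientation s) (ht : IsOrientation t)
    (hd : Admissible i j k l) :
    ((s i j k ↔ t i j k) ∧ (s i j l ↔ t i j l) ∧ (s i k l ↔ t i k l) ∧ (s j k l ↔ t j k l)) ∨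
    ((s i j k ↔ t i j k) ∧ (s i j l ↔ t i j l) ∧ (s i k l ↔ ¬ t i k l) ∧ (s j k l ↔ ¬ t j k l) ∧
      (s i k l ↔ s j k l) ∧ (s i j l ↔ ¬ s i j k)) ∨
    ((s i j k ↔ t i j k) ∧ (s i j l ↔ ¬ t i j l) ∧ (s i k l ↔ t i k l) ∧ (s j k l ↔ ¬ t j k l) ∧
      (s i j l ↔ ¬ s j k l) ∧ (s i j k ↔ s i k l)) ∨
    ((s i j k ↔ t i j k) ∧ (s i j l ↔ ¬ t i j l) ∧ (s i k l ↔ ¬ t i k l) ∧ (s j k l ↔ t j k l) ∧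
      (s i j l ↔ s i k l) ∧ (s i j k ↔ ¬ s j k l)) ∨
    ((s i j k ↔ ¬ t i j k) ∧ (s i j l ↔ t i j l) ∧ (s i k l ↔ t i k l) ∧ (s j k l ↔ ¬ t j k l) ∧
      (s i j k ↔ s j k l) ∧ (s i j l ↔ ¬ s i k l)) ∨
    ((s i j k ↔ ¬ t i j k) ∧ (s i j l ↔ t i j l) ∧ (s i k l ↔ ¬ t i k l) ∧ (s j k l ↔ t j k l) ∧
      (s i j k ↔ ¬ s i k l) ∧ (s i j l ↔ s j k l)) ∨
    ((s i j k ↔ ¬ t i j k) ∧ (s i j l ↔ ¬ t i j l) ∧ (s i k l ↔ t i k l) ∧ (s j k l ↔ t j k l) ∧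
      (s i j k ↔ s i j l) ∧ (s i k l ↔ ¬ s j k l)) := by
  have h1 := h.majorities hs ht hd
  have h2 := hs.not_of_inner hd
  have h3 := ht.not_of_inner hd
  unfold Majority at h1
  by_cases a1 : s i j k <;> by_cases a2 : s i j l <;> by_cases a3 : s i k l <;>
    by_cases a4 : s j k l <;> by_cases b1 : t i j k <;> by_cases b2 : t i j l <;>
    by_cases b3 : t i k l <;> by_cases b4 : t j k l <;>
    simp only [a1, a2, a3, a4, b1, b2, b3, b4] at h1 h2 h3 ⊢ <;> simp at h1 h2 h3 ⊢

end FourPoints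

section Agreement

variable {α : Type*} {s t u : α → α → α → Prop} {a b c d e x y : α}

lemma RadialEq.symm (h : RadialEq s t) : RadialEq t s :=
  fun i j k l hd => (h i j k l hd).symm

lemma RadialEq.trans (h : RadialEq s t) (h' : RadialEq t u) : RadialEq s u :=
  fun i j k l hd => (h i j k l hd).trans (h' i j k l hd)

/-- If `x` and `y` lie on the same side of `ab`, agreement on `abx` and `aby` propagates. -/
lemma RadialEq.iff_of_same_side (h : RadialEq s t) (hs : IsOrientation s) (ht : IsOrientation t)
    (hd : Admissible a b x y) (h1 : s a b x ↔ t a b x) (h2 : s a b y ↔ t a b y)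
    (h3 : s a b x ↔ s a b y) : (s a x y ↔ t a x y) ∧ (s b x y ↔ t b x y) := by
  rcases h.four hs ht hd with h | h | h | h | h | h | h <;> grind

lemma RadialEq.iff_of_three (h : RadialEq s t) (hs : IsOrientation s) (ht : IsOrientation t)
    (hd : Admissible a b x y) (h1 : s a b x ↔ t a b x) (h2 : s a b y ↔ t a b y)
    (h3 : s a x y ↔ t a x y) : s b x y ↔ t b x y := by
  rcases h.four hs ht hd with h | h | h | h | h | h | h <;> grind

/-- Agreement on `abc` propagates to `abcx` when `x` lies in the cone spanned by `b`, `c` at `a`. -/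
lemma RadialEq.iff_of_cone (h : RadialEq s t) (hs : IsOrientation s) (ht : IsOrientation t)
    (hd : Admissible a b c x) (h0 : s a b c) (h1 : s a b x) (h2 : ¬ s a c x) (h3 : t a b c) :
    t a b x ∧ ¬ t a c x ∧ (s b c x ↔ t b c x) := by
  rcases h.four hs ht hd with h | h | h | h | h | h | h <;> grind

/-- Four points in convex position have a rigid orientation. -/
lemma RadialEq.of_convex (h : RadialEq s t) (hs : IsOrientation s) (ht : IsOrientation t)
    (hd : Admissible a b c x) (h0 : s a b c) (h1 : s a b x) (h2 : ¬ s a c x) (h3 : ¬ s b c x) :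
    t a b c ∧ t a b x ∧ ¬ t a c x ∧ ¬ t b c x := by
  rcases h.four hs ht hd with h | h | h | h | h | h | h <;> grind

/-- If `x` is inside `abc` and `abc` is reversed, then so is exactly one of the triples formed by
`x` and an edge. -/
lemma RadialEq.reversed (h : RadialEq s t) (hs : IsOrientation s) (ht : IsOrientation t)
    (hd : Admissible a b c x) (h0 : s a b c) (h1 : s a b x) (h2 : ¬ s a c x) (h3 : s b c x)
    (h4 : ¬ t a b c) :
    (¬ t a b x ∧ t b c x ∧ ¬ t a c x) ∨ (t a b x ∧ ¬ t b c x ∧ ¬ t a c x) ∨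
      (t a b x ∧ t b c x ∧ t a c x) := by
  rcases h.four hs ht hd with h | h | h | h | h | h | h <;> grind

lemma IsOrientation.iff_not (hs : IsOrientation s) (hac : a ≠ c) (hax : a ≠ x) (hcx : c ≠ x) :
    s a c x ↔ ¬ s c a x := by
  rw [← hs.anti c a x hac.symm hcx hax, hs.cyc c x a, hs.cyc x a c]

/-- If the line `de` separates `c` from the edge `ab` of a triangle containing `d` and `e`, then
in a radially equivalent orientation `abd` and `abe` are preserved and a reversal of `cad` forces
one of `cae`. -/
lemma RadialEq.separated (h : RadialEq s t) (hs : IsOrientation s) (ht : IsOrientation t)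
    (hd : Admissible a b c d) (he : Admissible a b c e) (hde : d ≠ e)
    (habd : s a b d) (hcad : s c a d) (habe : s a b e) (hcae : s c a e)
    (hc : s d e c) (ha : ¬ s d e a) (hb : ¬ s d e b) :
    t a b d ∧ t a b e ∧ (¬ t c a d → ¬ t c a e) := by
  obtain ⟨hab, hac, had, hbc, hbd, hcd⟩ := hd
  obtain ⟨-, -, hae, -, hbe, hce⟩ := he
  rw [hs.cyc, hs.cyc] at hc ha hb
  obtain ⟨h1, h2, h3, h4⟩ := h.of_convex hs ht ⟨hab, had, hae, hbd, hbe, hde⟩ habd habe ha hb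
  refine ⟨h1, h2, ?_⟩
  have h5 := hs.iff_not hac had hcd
  have h6 := hs.iff_not hac hae hce
  have h7 := ht.iff_not hac had hcd
  have h8 := ht.iff_not hac hae hce
  rcases h.four hs ht ⟨hac, had, hae, hcd, hce, hde⟩ with h | h | h | h | h | h | h <;> grind

/-- Two radially equivalent orientations coincide as soon as they agree on all triples with two
members in `{a, b, c}` and any two points share a side with respect to some edge of `abc`. -/
lemma RadialEq.iff_of_edges (h : RadialEq s t) (hs : IsOrientation s) (ht : IsOrientation t)
    (hab : a ≠ b) (hac : a ≠ c) (hbc : b ≠ c)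
    (h0 : s a b c ↔ t a b c)
    (hx : ∀ x, a ≠ x → b ≠ x → c ≠ x →
      (s a b x ↔ t a b x) ∧ (s a c x ↔ t a c x) ∧ (s b c x ↔ t b c x))
    (hxy : ∀ x y, a ≠ x → b ≠ x → c ≠ x → a ≠ y → b ≠ y → c ≠ y →
      (s a b x ↔ s a b y) ∨ (s a c x ↔ s a c y) ∨ (s b c x ↔ s b c y)) :
    ∀ i j k, i ≠ j → i ≠ k → j ≠ k → (s i j k ↔ t i j k) := by
  have hax : ∀ x y, a ≠ x → a ≠ y → x ≠ y → (s a x y ↔ t a x y) := by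
    have hsw : ∀ x y, a ≠ x → a ≠ y → x ≠ y → (s a x y ↔ t a x y) → (s a y x ↔ t a y x) := by
      intro x y h1 h2 h3 h4
      rw [hs.anti a x y h1 h2 h3, ht.anti a x y h1 h2 h3, h4]
    intro x y hax hay hxy'
    by_cases hbx : b = x
    · subst hbx
      by_cases hcy : c = y
      · exact hcy ▸ h0
      · exact (hx y hay hxy' hcy).1
    by_cases hcx : c = x
    · subst hcx
      by_cases hby : b = y
      · exact hby ▸ hsw _ _ hab hac hbc h0
      · exact (hx y hay hby hxy').2.1
    by_cases hby : b = y
    · subst hby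
      exact hsw _ _ hab hax hbx (hx x hax hbx hcx).1
    by_cases hcy : c = y
    · subst hcy
      exact hsw _ _ hac hax hcx (hx x hax hbx hcx).2.1
    obtain ⟨x1, x2, x3⟩ := hx x hax hbx hcx
    obtain ⟨y1, y2, y3⟩ := hx y hay hby hcy
    rcases hxy x y hax hbx hcx hay hby hcy with e | e | e
    · exact (h.iff_of_same_side hs ht ⟨hab, hax, hay, hbx, hby, hxy'⟩ x1 y1 e).1
    · exact (h.iff_of_same_side hs ht ⟨hac, hax, hay, hcx, hcy, hxy'⟩ x2 y2 e).1
    · have hb := (h.iff_of_same_side hs ht ⟨hbc, hbx, hby, hcx, hcy, hxy'⟩ x3 y3 e).1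
      rcases h.four hs ht ⟨hab, hax, hay, hbx, hby, hxy'⟩ with h | h | h | h | h | h | h <;> grind
  intro i j k hij hik hjk
  by_cases hai : a = i
  · subst hai
    exact hax j k hij hik hjk
  by_cases haj : a = j
  · subst haj
    rw [hs.cyc, ht.cyc]
    exact hax k i hjk hij.symm hik.symm
  by_cases hak : a = k
  · subst hak
    rw [← hs.cyc, ← ht.cyc]
    exact hax i j hik.symm hjk.symm hij
  exact h.iff_of_three hs ht ⟨hai, haj, hak, hij, hik, hjk⟩ (hax _ _ hai haj hij)
    (hax _ _ hai hak hik) (hax _ _ haj hak hjk)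

end Agreement

/-- The edge of the triangle `abc` that is reversed as seen from `x`, when there is exactly one;
edges are numbered by the opposite vertex. -/
noncomputable def reversedEdge {α : Type*} (t : α → α → α → Prop) (a b c x : α) : Fin 3 :=
  open Classical in if ¬ t b c x then 0 else if ¬ t a b x then 2 else 1

section Triangle

variable {α : Type*} {s : α → α → α → Prop} {a b c : α}

lemma RadialEq.exists_reversedEdge (hs : IsOrientation s) {x y : α}
    (hx : Admissible a b c x) (hy : Admissible a b c y) (hxy : x ≠ y) (habc : s a b c)
    (hax : s a b x) (hbx : s b c x) (hcx : s c a x)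
    (hay : s a b y) (hby : s b c y) (hcy : s c a y) :
    ∃ p q : Fin 3, ∀ t, IsOrientation t → RadialEq s t → ¬ t a b c →
      (reversedEdge t a b c x = p ∧ reversedEdge t a b c y = p) ∨
      (reversedEdge t a b c x = p ∧ reversedEdge t a b c y = q) ∨
      (reversedEdge t a b c x = q ∧ reversedEdge t a b c y = q) := by
  have hx' := hx
  have hy' := hy
  obtain ⟨hab, hac, hax', hbc, hbx', hcx'⟩ := hx'
  obtain ⟨-, -, hay', -, hby', hcy'⟩ := hy'
  have rot : ∀ {a b c d : α}, Admissible a b c d → Admissible b c a d := by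
    rintro a b c d ⟨h1, h2, h3, h4, h5, h6⟩
    exact ⟨h4, h1.symm, h5, h2.symm, h6, h3⟩
  have nx := hs.surround a b c x y hax hbx hcx
  have ny := hs.surround a b c y x hay hby hcy
  have sw : ∀ v, x ≠ v → y ≠ v → (s y x v ↔ ¬ s x y v) := fun v h1 h2 =>
    hs.iff_not hxy.symm h2 h1
  have swa := sw a hax'.symm hay'.symm
  have swb := sw b hbx'.symm hby'.symm
  have swc := sw c hcx'.symm hcy'.symm
  have trip : ∀ t, IsOrientation t → RadialEq s t → ¬ t a b c →
      ((¬ t a b x ∧ t b c x ∧ t c a x) ∨ (t a b x ∧ ¬ t b c x ∧ t c a x) ∨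
      (t a b x ∧ t b c x ∧ ¬ t c a x)) ∧
      ((¬ t a b y ∧ t b c y ∧ t c a y) ∨ (t a b y ∧ ¬ t b c y ∧ t c a y) ∨
      (t a b y ∧ t b c y ∧ ¬ t c a y)) := by
    intro t ht h hn
    have h1 := h.reversed hs ht hx habc hax
    have h2 := h.reversed hs ht hy habc hay
    rw [hs.iff_not hac hax' hcx', ht.iff_not hac hax' hcx'] at h1
    rw [hs.iff_not hac hay' hcy', ht.iff_not hac hay' hcy'] at h2
    grind
  by_cases ea : s x y a <;> by_cases eb : s x y b <;> by_cases ec : s x y c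
  · grind
  · refine ⟨1, 0, fun t ht h hn => ?_⟩
    have := h.separated hs ht hy hx hxy.symm hay hcy hax hcx (by grind) (by grind) (by grind)
    have := trip t ht h hn
    unfold reversedEdge
    split_ifs <;> first | (simp; done) | grind
  · refine ⟨0, 2, fun t ht h hn => ?_⟩
    have := h.separated hs ht (rot (rot hy)) (rot (rot hx)) hxy.symm hcy hby hcx hbx
      (by grind) (by grind) (by grind)
    have := trip t ht h hn
    unfold reversedEdge
    split_ifs <;> first | (simp; done) | grind
  · refine ⟨1, 2, fun t ht h hn => ?_⟩
    have := h.separated hs ht (rot hx) (rot hy) hxy hbx hax hby hay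
      (by grind) (by grind) (by grind)
    have := trip t ht h hn
    unfold reversedEdge
    split_ifs <;> first | (simp; done) | grind
  · refine ⟨2, 1, fun t ht h hn => ?_⟩
    have := h.separated hs ht (rot hy) (rot hx) hxy.symm hby hay hbx hax
      (by grind) (by grind) (by grind)
    have := trip t ht h hn
    unfold reversedEdge
    split_ifs <;> first | (simp; done) | grind
  · refine ⟨2, 0, fun t ht h hn => ?_⟩
    have := h.separated hs ht (rot (rot hx)) (rot (rot hy)) hxy hcx hbx hcy hby
      (by grind) (by grind) (by grind)
    have := trip t ht h hn
    unfold reversedEdge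
    split_ifs <;> first | (simp; done) | grind
  · refine ⟨0, 1, fun t ht h hn => ?_⟩
    have := h.separated hs ht hx hy hxy hax hcx hay hcy (by grind) (by grind) (by grind)
    have := trip t ht h hn
    unfold reversedEdge
    split_ifs <;> first | (simp; done) | grind
  · grind

end Triangle

/-- A family of functions in which any two coordinates take at most three joint values, arranged
as `(p, p), (p, q), (q, q)`, has at most one more member than there are coordinates. -/
lemma card_le_card_add_one_of_pairs {ι γ : Type*} [Fintype ι] [Nontrivial ι]
    (F : Finset (ι → γ))
    (h : ∀ x y, x ≠ y → ∃ p q, ∀ f ∈ F,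
      (f x = p ∧ f y = p) ∨ (f x = p ∧ f y = q) ∨ (f x = q ∧ f y = q)) :
    F.card ≤ Fintype.card ι + 1 := by
  classical
  have h1 : ∀ x, ∃ p q, ∀ f ∈ F, f x = p ∨ f x = q := by
    intro x
    obtain ⟨y, hy⟩ := exists_ne x
    obtain ⟨p, q, hpq⟩ := h x y hy.symm
    exact ⟨p, q, fun f hf => by rcases hpq f hf with h | h | h <;> simp [h.1]⟩
  choose p q hpq using h1
  let A : (ι → γ) → Finset ι := fun f => Finset.univ.filter fun x => f x = p x
  have hA : ∀ f x, x ∈ A f ↔ f x = p x := fun f x => by simp [A]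
  have hinj : Set.InjOn A F := by
    intro f hf g hg hfg
    ext x
    have h1 := hA f x
    rw [hfg, hA g x] at h1
    rcases hpq x f hf with h2 | h2 <;> rcases hpq x g hg with h3 | h3 <;> simp_all
  rw [← Finset.card_image_of_injOn hinj]
  have hvc : (F.image A).vcDim ≤ 1 := by
    refine Finset.sup_le fun s hs => ?_
    rw [Finset.mem_shatterer] at hs
    by_contra! hc
    obtain ⟨x, hx, y, hy, hxy⟩ := Finset.one_lt_card.1 hc
    have key : ∀ P Q : Prop, ∃ f ∈ F, (f x = p x ↔ P) ∧ (f y = p y ↔ Q) := by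
      intro P Q
      obtain ⟨w, hw, hsw⟩ := hs (t := s.filter fun z => (z = x ∧ P) ∨ (z = y ∧ Q))
        (Finset.filter_subset _ _)
      obtain ⟨f, hf, rfl⟩ := Finset.mem_image.1 hw
      refine ⟨f, hf, ?_, ?_⟩
      · have := congrArg (x ∈ ·) hsw
        simpa [hx, hA, hxy] using this
      · have := congrArg (y ∈ ·) hsw
        simpa [hy, hA, hxy.symm] using this
    obtain ⟨u, v, huv⟩ := h x y hxy
    obtain ⟨f1, m1, f1x, f1y⟩ := key True True
    obtain ⟨f2, m2, f2x, f2y⟩ := key True False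
    obtain ⟨f3, m3, f3x, f3y⟩ := key False True
    obtain ⟨f4, m4, f4x, f4y⟩ := key False False
    have n1 := huv f1 m1
    have n2 := huv f2 m2
    have n3 := huv f3 m3
    have n4 := huv f4 m4
    grind
  calc (F.image A).card ≤ (F.image A).shatterer.card := Finset.card_le_card_shatterer _
    _ ≤ ∑ k ∈ Finset.Iic (F.image A).vcDim, (Fintype.card ι).choose k :=
      Finset.card_shatterer_le_sum_vcDim
    _ ≤ ∑ k ∈ Finset.Iic 1, (Fintype.card ι).choose k :=
      Finset.sum_le_sum_of_subset (Finset.Iic_subset_Iic.2 hvc)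
    _ = Fintype.card ι + 1 := by
      rw [show Finset.Iic 1 = {0, 1} from rfl]
      simp [add_comm]

section Chirotope

variable {α : Type*} {P Q : α → ℝ × ℝ}

lemma chi_eq_one_iff (P : α → ℝ × ℝ) (i j k : α) :
    chi P i j k = 1 ↔ 0 < det2 (P j - P i) (P k - P i) := by
  unfold chi
  rcases lt_trichotomy (det2 (P j - P i) (P k - P i)) 0 with h | h | h
  · rw [Real.sign_of_neg h]
    constructor <;> intro h' <;> linarith
  · simp [h]
  · simp [Real.sign_of_pos h, h]

lemma GenPos.isOrientation (hP : GenPos P) : IsOrientation fun i j k => chi P i j k = 1 where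
  cyc i j k := by
    simp only [chi_eq_one_iff]
    rw [show det2 (P j - P i) (P k - P i) = det2 (P k - P j) (P i - P j) by
      simp only [det2, Prod.fst_sub, Prod.snd_sub]; ring]
  anti i j k hij hik hjk := by
    have h0 : det2 (P j - P i) (P k - P i) ≠ 0 := fun h => hP i j k hij hik hjk (by simp [chi, h])
    simp only [chi_eq_one_iff]
    rw [show det2 (P k - P i) (P j - P i) = -det2 (P j - P i) (P k - P i) by
      simp only [det2]; ring, Left.neg_pos_iff, not_lt]
    exact ⟨le_of_lt, fun h => lt_of_le_of_ne h h0⟩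
  inner i j k l := by
    simp only [chi_eq_one_iff]
    rw [show det2 (P j - P i) (P k - P i) = det2 (P j - P i) (P l - P i) +
      det2 (P k - P j) (P l - P j) + det2 (P i - P k) (P l - P k) by
      simp only [det2, Prod.fst_sub, Prod.snd_sub]; ring]
    intros
    positivity
  surround i j k x y := by
    simp only [chi_eq_one_iff]
    rintro h1 h2 h3 ⟨h4, h5, h6⟩
    have := mul_pos h2 h4
    have := mul_pos h3 h5
    have := mul_pos h1 h6
    have : det2 (P k - P j) (P x - P j) * det2 (P y - P x) (P i - P x) +
        det2 (P i - P k) (P x - P k) * det2 (P y - P x) (P j - P x) +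
        det2 (P j - P i) (P x - P i) * det2 (P y - P x) (P k - P x) = 0 := by
      simp only [det2, Prod.fst_sub, Prod.snd_sub]
      ring
    linarith

lemma SameRadial.radialEq (h : SameRadial P Q) :
    RadialEq (fun i j k => chi P i j k = 1) fun i j k => chi Q i j k = 1 := h

lemma chi_eq_of_iff (hP : GenPos P) (hQ : GenPos Q)
    (h : ∀ i j k, i ≠ j → i ≠ k → j ≠ k → (chi P i j k = 1 ↔ chi Q i j k = 1)) :
    chi P = chi Q := by
  have hdeg : ∀ (R : α → ℝ × ℝ) i j k, ¬ (i ≠ j ∧ i ≠ k ∧ j ≠ k) → chi R i j k = 0 := by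
    intro R i j k hd
    have : det2 (R j - R i) (R k - R i) = 0 := by
      by_cases h1 : i = j
      · simp [h1, det2]
      by_cases h2 : i = k
      · simp [h2, det2]
      have h3 : j = k := by tauto
      simp only [h3, det2]
      ring
    simp [chi, this]
  have hval : ∀ (R : α → ℝ × ℝ) i j k, chi R i j k = -1 ∨ chi R i j k = 0 ∨ chi R i j k = 1 :=
    fun R i j k => Real.sign_apply_eq _
  ext i j k
  by_cases hd : i ≠ j ∧ i ≠ k ∧ j ≠ k
  · obtain ⟨h1, h2, h3⟩ := hd
    have := h i j k h1 h2 h3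
    have := hP i j k h1 h2 h3
    have := hQ i j k h1 h2 h3
    have := hval P i j k
    have := hval Q i j k
    grind
  · rw [hdeg P i j k hd, hdeg Q i j k hd]

/-- There is a point at which all other points lie in a cone spanned by two of them. -/
lemma GenPos.exists_cone [Finite α] (hP : GenPos P) (hinj : Function.Injective P)
    (hcard : 3 ≤ Nat.card α) :
    ∃ a b c : α, a ≠ b ∧ a ≠ c ∧ b ≠ c ∧ (∀ x, a ≠ x → b ≠ x → chi P a b x = 1) ∧
      ∀ x, a ≠ x → c ≠ x → chi P c a x = 1 := by
  have hO := hP.isOrientation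
  have : Nonempty α := (Nat.card_pos_iff.1 (by omega)).1
  obtain ⟨a, ha⟩ := Finite.exists_min fun i => toLex (P i)
  have hhalf : ∀ x : {x // a ≠ x}, 0 < (P x - P a).1 ∨ ((P x - P a).1 = 0 ∧ 0 < (P x - P a).2) := by
    rintro ⟨x, hx⟩
    have h1 : toLex (P a) < toLex (P x) :=
      lt_of_le_of_ne (ha x) fun h => hx (hinj (toLex.injective h))
    rw [Prod.Lex.toLex_lt_toLex] at h1
    simp only [Prod.fst_sub, Prod.snd_sub, sub_pos, sub_eq_zero]
    tauto
  let r : {x // a ≠ x} → {x // a ≠ x} → Prop := fun x y => chi P a x y = 1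
  have htrans : ∀ x y z, r x y → r y z → r x z := by
    intro x y z hxy hyz
    simp only [r, chi_eq_one_iff] at *
    have hx := hhalf x
    have hy := hhalf y
    have hz := hhalf z
    generalize P x - P a = u at *
    generalize P y - P a = v at *
    generalize P z - P a = w at *
    simp only [det2] at *
    have hid : v.1 * (u.1 * w.2 - u.2 * w.1) =
        u.1 * (v.1 * w.2 - v.2 * w.1) + w.1 * (u.1 * v.2 - u.2 * v.1) := by ring
    have hu : 0 ≤ u.1 := by rcases hx with h | h <;> linarith
    have hw : 0 ≤ w.1 := by rcases hz with h | h <;> linarith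
    rcases hy with hv | ⟨hv, hv'⟩
    · refine pos_of_mul_pos_right ?_ hv.le
      rw [hid]
      rcases hx with h | ⟨h, h'⟩
      · exact add_pos_of_pos_of_nonneg (mul_pos h hyz) (mul_nonneg hw hxy.le)
      · rw [h] at hxy
        nlinarith [mul_pos hv h']
    · rw [hv] at hyz
      nlinarith [mul_nonneg hw hv'.le]
  have hirr : ∀ x, ¬ r x x := by
    intro x
    simp only [r, chi_eq_one_iff, det2]
    intro h
    linarith
  have htot : ∀ x y, x ≠ y → ¬ r x y → r y x := fun x y hxy h =>
    (hO.anti a x y x.2 y.2 (Subtype.coe_ne_coe.2 hxy)).2 h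
  have : IsTrans _ r := ⟨htrans⟩
  have : Std.Irrefl r := ⟨hirr⟩
  have : IsTrans _ (Function.swap r) := ⟨fun x y z h1 h2 => htrans z y x h2 h1⟩
  have : Std.Irrefl (Function.swap r) := ⟨hirr⟩
  obtain ⟨z, hz⟩ : ∃ z, a ≠ z := by
    by_contra! h
    have : Subsingleton α := ⟨fun x y => (h x).symm.trans (h y)⟩
    have := Finite.card_le_one_iff_subsingleton.2 this
    omega
  obtain ⟨b, -, hb⟩ := (Finite.wellFounded_of_trans_of_irrefl r).has_min Set.univ ⟨⟨z, hz⟩, trivial⟩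
  obtain ⟨c, -, hc⟩ := (Finite.wellFounded_of_trans_of_irrefl (Function.swap r)).has_min Set.univ
    ⟨⟨z, hz⟩, trivial⟩
  have hb' : ∀ x, x ≠ b → r b x := fun x hx => htot x b hx (hb x trivial)
  have hc' : ∀ x, x ≠ c → r x c := fun x hx => htot c x hx.symm (hc x trivial)
  have hbc : b ≠ c := by
    rintro rfl
    have hall : ∀ x, x = b := by
      intro x
      by_contra hx
      exact hirr _ (htrans _ _ _ (hb' x hx) (hc' x hx))
    have hle : Nat.card α ≤ 2 := by
      classical
      have := Fintype.ofFinite α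
      have hu : (Finset.univ : Finset α) ⊆ {a, (b : α)} := by
        intro x _
        by_cases hx : a = x
        · simp [hx]
        · simp [← hall ⟨x, hx⟩]
      rw [Nat.card_eq_fintype_card, ← Finset.card_univ]
      exact (Finset.card_le_card hu).trans Finset.card_le_two
    omega
  refine ⟨a, b, c, b.2, c.2, Subtype.coe_ne_coe.2 hbc, fun x h1 h2 => ?_, fun x h1 h2 => ?_⟩
  · exact hb' ⟨x, h1⟩ fun h => h2 (congrArg Subtype.val h).symm
  · exact (hO.cyc c a x).2 (hc' ⟨x, h1⟩ fun h => h2 (congrArg Subtype.val h).symm)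

end Chirotope

section Counting

variable {α : Type*} {s : α → α → α → Prop} {a b c : α}

/-- At a point whose cone contains everything, the orientation of that one triple decides. -/
lemma RadialEq.eq_of_cone {t : α → α → α → Prop} (h : RadialEq s t) (hs : IsOrientation s)
    (ht : IsOrientation t) (hab : a ≠ b) (hac : a ≠ c) (hbc : b ≠ c)
    (hb : ∀ x, a ≠ x → b ≠ x → s a b x) (hc : ∀ x, a ≠ x → c ≠ x → s c a x) (habc : t a b c) :
    ∀ i j k, i ≠ j → i ≠ k → j ≠ k → (s i j k ↔ t i j k) := by
  refine h.iff_of_edges hs ht hab hac hbc (iff_of_true (hb c hac hbc) habc) ?_ ?_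
  · intro x hax hbx hcx
    have hcx' : ¬ s a c x := by
      rw [hs.iff_not hac hax hcx, not_not]
      exact hc x hax hcx
    have := h.iff_of_cone hs ht ⟨hab, hac, hax, hbc, hbx, hcx⟩ (hb c hac hbc) (hb x hax hbx)
      hcx' habc
    have := hb x hax hbx
    tauto
  · intro x y hax hbx _ hay hby _
    exact Or.inl (iff_of_true (hb x hax hbx) (hb y hay hby))

/-- A reversal of the triangle `abc` is determined by its reversed edges. -/
lemma RadialEq.eq_of_reversedEdge {t u : α → α → α → Prop} (hst : RadialEq s t)
    (hsu : RadialEq s u) (hs : IsOrientation s) (ht : IsOrientation t) (hu : IsOrientation u)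
    (hab : a ≠ b) (hac : a ≠ c) (hbc : b ≠ c)
    (hb : ∀ x, a ≠ x → b ≠ x → s a b x) (hc : ∀ x, a ≠ x → c ≠ x → s c a x)
    (hbcx : ∀ x, b ≠ x → c ≠ x → s b c x) (habc : ¬ t a b c) (habc' : ¬ u a b c)
    (he : ∀ x, a ≠ x → b ≠ x → c ≠ x → reversedEdge t a b c x = reversedEdge u a b c x) :
    ∀ i j k, i ≠ j → i ≠ k → j ≠ k → (t i j k ↔ u i j k) := by
  have rev : ∀ {v : α → α → α → Prop}, RadialEq s v → IsOrientation v → ¬ v a b c → ∀ x,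
      a ≠ x → b ≠ x → c ≠ x →
      (¬ v a b x ∧ v b c x ∧ ¬ v a c x) ∨ (v a b x ∧ ¬ v b c x ∧ ¬ v a c x) ∨
        (v a b x ∧ v b c x ∧ v a c x) := by
    intro v h hv hn x hax hbx hcx
    have hcx' : ¬ s a c x := by
      rw [hs.iff_not hac hax hcx, not_not]
      exact hc x hax hcx
    exact h.reversed hs hv ⟨hab, hac, hax, hbc, hbx, hcx⟩ (hb c hac hbc) (hb x hax hbx)
      hcx' (hbcx x hbx hcx) hn
  refine (hst.symm.trans hsu).iff_of_edges ht hu hab hac hbc (iff_of_false habc habc') ?_ ?_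
  · intro x hax hbx hcx
    have h1 := rev hst ht habc x hax hbx hcx
    have h2 := rev hsu hu habc' x hax hbx hcx
    have h3 := he x hax hbx hcx
    unfold reversedEdge at h3
    split_ifs at h3 <;> first | (simp at h3; done) | grind
  · intro x y hax hbx hcx hay hby hcy
    have h1 := rev hst ht habc x hax hbx hcx
    have h2 := rev hst ht habc y hay hby hcy
    grind

end Counting

/-- at most `n - 1` chirotopes share the radial system of a
given configuration. -/
theorem chirotopes_with_same_radial_system_le {n : ℕ} (hn : 5 ≤ n)
    (P₀ : Fin n → ℝ × ℝ)
    (hinj : Function.Injective P₀) (hgp : GenPos P₀) :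
    {f : Fin n → Fin n → Fin n → ℝ |
        ∃ Q : Fin n → ℝ × ℝ, Function.Injective Q ∧ GenPos Q ∧
          SameRadial P₀ Q ∧ f = chi Q}.ncard ≤ n - 1 := by
  classical
  obtain ⟨a, b, c, hab, hac, hbc, hb, hc⟩ := hgp.exists_cone hinj (by simp; omega)
  have hO := hgp.isOrientation
  set S := {f : Fin n → Fin n → Fin n → ℝ |
        ∃ Q : Fin n → ℝ × ℝ, Function.Injective Q ∧ GenPos Q ∧
          SameRadial P₀ Q ∧ f = chi Q}
  let T := {f ∈ S | f a b c ≠ 1}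
  have hsub : S ⊆ insert (chi P₀) T := by
    intro f hf
    by_cases habc : f a b c = 1
    · left
      obtain ⟨Q, -, hQ, hr, rfl⟩ := hf
      exact (chi_eq_of_iff hgp hQ (hr.radialEq.eq_of_cone hO hQ.isOrientation hab hac hbc
        hb hc habc)).symm
    · exact Or.inr ⟨hf, habc⟩
  have hcax : ∀ x, a ≠ x → c ≠ x → ¬ chi P₀ a c x = 1 := fun x h1 h2 => by
    rw [hO.iff_not hac h1 h2, not_not]
    exact hc x h1 h2
  have hT : T.Finite ∧ T.ncard ≤ n - 2 := by
    by_cases hin : ∀ x, b ≠ x → c ≠ x → chi P₀ b c x = 1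
    · let ι := {x : Fin n // a ≠ x ∧ b ≠ x ∧ c ≠ x}
      have hcard : Fintype.card ι = n - 3 := by
        have : Fintype.card ι = ((Finset.univ : Finset (Fin n)) \ {a, b, c}).card := by
          rw [Fintype.card_subtype]
          congr 1
          ext x
          simp [eq_comm]
        rw [this, Finset.card_sdiff_of_subset (Finset.subset_univ _),
          Finset.card_eq_three.2 ⟨a, b, c, hab, hac, hbc, rfl⟩]
        simp
      have : Nontrivial ι := Fintype.one_lt_card_iff_nontrivial.1 (by omega)
      let κ : (Fin n → Fin n → Fin n → ℝ) → ι → Fin 3 := fun f x =>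
        reversedEdge (fun i j k => f i j k = 1) a b c x
      have hκ : Set.InjOn κ T := by
        rintro _ ⟨⟨Q, -, hQ, hr, rfl⟩, hf⟩ _ ⟨⟨R, -, hR, hr', rfl⟩, hg⟩ hfg
        exact chi_eq_of_iff hQ hR (hr.radialEq.eq_of_reversedEdge hr'.radialEq hO
          hQ.isOrientation hR.isOrientation hab hac hbc hb hc hin hf hg
          fun x h1 h2 h3 => congrFun hfg ⟨x, h1, h2, h3⟩)
      have hfin : T.Finite := Set.Finite.of_finite_image (Set.toFinite (κ '' T)) hκ
      refine ⟨hfin, ?_⟩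
      rw [← hκ.ncard_image, Set.ncard_eq_toFinset_card' (κ '' T)]
      refine (card_le_card_add_one_of_pairs _ ?_).trans (by omega)
      rintro ⟨x, hax, hbx, hcx⟩ ⟨y, hay, hby, hcy⟩ hxy
      obtain ⟨p, q, hpq⟩ := RadialEq.exists_reversedEdge hO
        ⟨hab, hac, hax, hbc, hbx, hcx⟩ ⟨hab, hac, hay, hbc, hby, hcy⟩
        (fun h => hxy (Subtype.ext h)) (hb c hac hbc) (hb x hax hbx) (hin x hbx hcx) (hc x hax hcx)
        (hb y hay hby) (hin y hby hcy) (hc y hay hcy)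
      refine ⟨p, q, fun f hf => ?_⟩
      obtain ⟨_, ⟨⟨Q, -, hQ, hr, rfl⟩, habc⟩, rfl⟩ := Set.mem_toFinset.1 hf
      exact hpq _ hQ.isOrientation hr.radialEq habc
    · push Not at hin
      obtain ⟨x, hbx, hcx, hx⟩ := hin
      have hax : a ≠ x := by
        rintro rfl
        exact hx ((hO.cyc a b c).1 (hb c hac hbc))
      have hempty : T = ∅ := by
        refine Set.eq_empty_of_forall_notMem ?_
        rintro _ ⟨⟨Q, -, hQ, hr, rfl⟩, hf⟩
        exact hf (hr.radialEq.of_convex hO hQ.isOrientation ⟨hab, hac, hax, hbc, hbx, hcx⟩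
          (hb c hac hbc) (hb x hax hbx) (hcax x hax hcx) hx).1
      simp [hempty]
  calc S.ncard ≤ (insert (chi P₀) T).ncard := Set.ncard_le_ncard hsub (hT.1.insert _)
    _ ≤ T.ncard + 1 := Set.ncard_insert_le _ _
    _ ≤ n - 1 := by omega
end

section
/- Let n ≥ 5 and let P₀ : Fin n → ℝ² be a configuration of n labeled points (injective, in general position); call a subset H ⊆ Fin n an important set if H is the extreme set of some configuration Q on Fin n with the same radial system as P₀. If there exist at least three pairwise distinct important sets each of cardinality 3, then there exists an index i* ∈ Fin n that belongs to every important set of cardinality 3. -/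
/-- The triple `(i, j, k)` is positively oriented. -/
def Pos {α : Type*} (P : α → ℝ × ℝ) (i j k : α) : Prop := chi P i j k = 1

/-- The signed doubled area of the triangle `i j k`. -/
noncomputable def area {α : Type*} (P : α → ℝ × ℝ) (i j k : α) : ℝ :=
  det2 (P j - P i) (P k - P i)

/-- The point `d` lies strictly inside the triangle `a b c`. -/
def Inside {α : Type*} (P : α → ℝ × ℝ) (d a b c : α) : Prop :=
  (Pos P a b d ∧ Pos P b c d ∧ Pos P c a d) ∨ (Pos P b a d ∧ Pos P c b d ∧ Pos P a c d)

/-- The orientation of `x y z` differs in `P` and `Q`. -/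
def Differ {α : Type*} (P Q : α → ℝ × ℝ) (x y z : α) : Prop :=
  ¬ (Pos P x y z ↔ Pos Q x y z)

section Orientation

variable {α : Type*} {P Q : α → ℝ × ℝ} {a b c d x y z : α}

lemma pos_iff : Pos P x y z ↔ 0 < area P x y z := by
  unfold Pos chi area
  rcases lt_trichotomy (det2 (P y - P x) (P z - P x)) 0 with h | h | h
  · rw [Real.sign_of_neg h]; constructor <;> intro <;> linarith
  · simp [h]
  · simp [Real.sign_of_pos h, h]

lemma area_rot (P : α → ℝ × ℝ) (x y z : α) : area P x y z = area P y z x := by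
  simp only [area, det2, Prod.fst_sub, Prod.snd_sub]; ring

lemma area_swap (P : α → ℝ × ℝ) (x y z : α) : area P x z y = - area P x y z := by
  simp only [area, det2, Prod.fst_sub, Prod.snd_sub]; ring

lemma area_swap_left (P : α → ℝ × ℝ) (x y z : α) : area P y x z = - area P x y z := by
  simp only [area, det2, Prod.fst_sub, Prod.snd_sub]; ring

lemma area_add (P : α → ℝ × ℝ) (a b c d : α) :
    area P a b c = area P a b d + area P b c d + area P c a d := by
  simp only [area, det2, Prod.fst_sub, Prod.snd_sub]; ring

lemma area_ne_zero (hP : GenPos P) (hxy : x ≠ y) (hxz : x ≠ z) (hyz : y ≠ z) :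
    area P x y z ≠ 0 := by
  intro h
  apply hP x y z hxy hxz hyz
  unfold area at h
  simp [chi, h]

lemma pos_rot (P : α → ℝ × ℝ) (x y z : α) : Pos P x y z ↔ Pos P y z x := by
  rw [pos_iff, pos_iff, area_rot]

lemma pos_swap (hP : GenPos P) (hxy : x ≠ y) (hxz : x ≠ z) (hyz : y ≠ z) :
    Pos P x z y ↔ ¬ Pos P x y z := by
  have := area_ne_zero hP hxy hxz hyz
  rw [pos_iff, pos_iff, area_swap]
  constructor
  · intro h; linarith
  · intro h
    have := lt_of_le_of_ne (not_lt.1 h) this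
    linarith

lemma not_pos_self (P : α → ℝ × ℝ) (x y : α) : ¬ Pos P x x y := by
  simp [pos_iff, area, det2]

lemma pos_of_pos (h₁ : Pos P a b d) (h₂ : Pos P b c d) (h₃ : Pos P c a d) : Pos P a b c := by
  rw [pos_iff] at *
  rw [area_add P a b c d]; linarith

lemma not_differ_self (P Q : α → ℝ × ℝ) (x y : α) : ¬ Differ P Q x x y := by
  simp [Differ, not_pos_self]

lemma differ_rot (P Q : α → ℝ × ℝ) (x y z : α) : Differ P Q x y z ↔ Differ P Q y z x := by
  rw [Differ, Differ, pos_rot P, pos_rot Q]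

lemma differ_swap (hP : GenPos P) (hQ : GenPos Q) (x y z : α) :
    Differ P Q x y z ↔ Differ P Q x z y := by
  by_cases hxy : x = y
  · subst hxy
    simp [differ_rot P Q x z x, differ_rot P Q z x x, not_differ_self]
  by_cases hyz : y = z
  · subst hyz; rfl
  by_cases hxz : x = z
  · subst hxz
    simp [differ_rot P Q x y x, differ_rot P Q y x x, not_differ_self]
  rw [Differ, Differ, pos_swap hP hxy hxz hyz, pos_swap hQ hxy hxz hyz]
  tauto

lemma differ_comm (P Q : α → ℝ × ℝ) (x y z : α) : Differ P Q x y z ↔ Differ Q P x y z := by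
  unfold Differ; tauto

lemma differ_trans {R : α → ℝ × ℝ} :
    Differ Q R x y z ↔ ¬ (Differ P Q x y z ↔ Differ P R x y z) := by
  unfold Differ; tauto

/-- The radial and containment relations of four points in terms of their orientations. -/
lemma four_points_pos (hP : GenPos P)
    (hab : a ≠ b) (hac : a ≠ c) (had : a ≠ d) (hbc : b ≠ c) (hbd : b ≠ d) (hcd : c ≠ d) :
    ∃ A B C D : Prop,
      (Pos P a b c ↔ A) ∧ (Pos P a b d ↔ B) ∧ (Pos P a c d ↔ C) ∧ (Pos P b c d ↔ D) ∧
      (Ccw P a b c d ↔ A ∧ C ∨ C ∧ ¬ B ∨ ¬ B ∧ A) ∧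
      (Ccw P b a c d ↔ ¬ A ∧ D ∨ D ∧ B ∨ B ∧ ¬ A) ∧
      (Ccw P c a b d ↔ A ∧ ¬ D ∨ ¬ D ∧ C ∨ C ∧ A) ∧
      (Ccw P d a b c ↔ B ∧ D ∨ D ∧ ¬ C ∨ ¬ C ∧ B) ∧
      (Inside P d a b c ↔ B ∧ D ∧ ¬ C ∨ ¬ B ∧ ¬ D ∧ C) ∧
      (Inside P c a b d ↔ A ∧ ¬ D ∧ C ∨ ¬ A ∧ D ∧ ¬ C) ∧
      (B → D → ¬ C → A) ∧ (¬ B → ¬ D → C → ¬ A) := by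
  have orient : ∀ {x y z : α}, x ≠ y → x ≠ z → y ≠ z →
      (Pos P x z y ↔ ¬ Pos P x y z) ∧ (Pos P y x z ↔ ¬ Pos P x y z) ∧
      (Pos P z y x ↔ ¬ Pos P x y z) ∧ (Pos P y z x ↔ Pos P x y z) ∧
      (Pos P z x y ↔ Pos P x y z) := by
    intro x y z hxy hxz hyz
    have h := pos_swap hP hxy hxz hyz
    refine ⟨h, ?_, ?_, (pos_rot P x y z).symm, pos_rot P z x y⟩
    · rw [pos_rot P y x z]; exact h
    · rw [← pos_rot P x z y]; exact h
  obtain ⟨p₁, p₂, p₃, p₄, p₅⟩ := orient hab hac hbc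
  obtain ⟨q₁, q₂, q₃, q₄, q₅⟩ := orient hab had hbd
  obtain ⟨s₁, s₂, s₃, s₄, s₅⟩ := orient hac had hcd
  obtain ⟨t₁, t₂, t₃, t₄, t₅⟩ := orient hbc hbd hcd
  refine ⟨_, _, _, _, Iff.rfl, Iff.rfl, Iff.rfl, Iff.rfl, ?_, ?_, ?_, ?_, ?_, ?_, ?_, ?_⟩
  · rw [← q₁]; rfl
  · rw [← p₂, ← q₄]; rfl
  · rw [← p₅, ← s₄, ← t₂]; rfl
  · rw [← q₅, ← t₅, ← s₃]; rfl
  · simp only [Inside, q₂, s₂, t₂]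
  · simp only [Inside, p₂, s₅, t₁, t₅, s₁]
  · exact fun h₁ h₂ h₃ => pos_of_pos h₁ h₂ (s₂.2 h₃)
  · exact fun h₁ h₂ h₃ => p₁.1 (pos_of_pos h₃ (t₂.2 h₂) (q₂.2 h₁))

/-- Configurations with the same radial system differ in none or exactly two of the four triples
of a quadruple; in the latter case the quadruple is not in convex position. -/
lemma four_points (hP : GenPos P) (hQ : GenPos Q) (hr : SameRadial P Q)
    (hab : a ≠ b) (hac : a ≠ c) (had : a ≠ d) (hbc : b ≠ c) (hbd : b ≠ d) (hcd : c ≠ d) :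
    (Differ P Q a b c → ¬ Differ P Q a b d → ¬ Differ P Q a c d → Differ P Q b c d) ∧
    (Differ P Q a b c → Differ P Q a b d → ¬ Differ P Q a c d ∧ ¬ Differ P Q b c d ∧
      ((Inside P d a b c ∧ Inside Q c a b d) ∨ (Inside P c a b d ∧ Inside Q d a b c))) := by
  have r₁ := hr a b c d ⟨hab, hac, had, hbc, hbd, hcd⟩
  have r₂ := hr b a c d ⟨hab.symm, hbc, hbd, hac, had, hcd⟩
  have r₃ := hr c a b d ⟨hac.symm, hbc.symm, hcd, hab, had, hbd⟩
  have r₄ := hr d a b c ⟨had.symm, hbd.symm, hcd.symm, hab, hac, hbc⟩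
  obtain ⟨A, B, C, D, p₁, p₂, p₃, p₄, p₅, p₆, p₇, p₈, p₉, p₁₀, hp, hp'⟩ :=
    four_points_pos hP hab hac had hbc hbd hcd
  obtain ⟨A', B', C', D', q₁, q₂, q₃, q₄, q₅, q₆, q₇, q₈, q₉, q₁₀, hq, hq'⟩ :=
    four_points_pos hQ hab hac had hbc hbd hcd
  simp only [Differ, p₁, p₂, p₃, p₄, p₅, p₆, p₇, p₈, p₉, p₁₀, q₁, q₂, q₃, q₄, q₅, q₆, q₇, q₈, q₉,
    q₁₀] at r₁ r₂ r₃ r₄ ⊢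
  clear p₁ p₂ p₃ p₄ p₅ p₆ p₇ p₈ p₉ p₁₀ q₁ q₂ q₃ q₄ q₅ q₆ q₇ q₈ q₉ q₁₀
  clear hr hP hQ hab hac had hbc hbd hcd
  by_cases A <;> by_cases B <;> by_cases C <;> by_cases D <;> simp_all <;> grind

lemma differ_ne (h : Differ P Q x y z) : x ≠ y ∧ x ≠ z ∧ y ≠ z := by
  refine ⟨?_, ?_, ?_⟩ <;> rintro rfl
  · exact not_differ_self _ _ _ _ h
  · rw [← differ_rot] at h
    exact not_differ_self _ _ _ _ h
  · rw [differ_rot] at h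
    exact not_differ_self _ _ _ _ h

lemma differ_exchange (hP : GenPos P) (hQ : GenPos Q) (hr : SameRadial P Q)
    (h : Differ P Q a b c) (h' : Differ P Q a b d) (hcd : c ≠ d) :
    (Inside P d a b c ∧ Inside Q c a b d) ∨ (Inside P c a b d ∧ Inside Q d a b c) := by
  obtain ⟨hab, hac, hbc⟩ := differ_ne h
  obtain ⟨-, had, hbd⟩ := differ_ne h'
  exact ((four_points hP hQ hr hab hac had hbc hbd hcd).2 h h').2.2

lemma differ_even (hP : GenPos P) (hQ : GenPos Q) (hr : SameRadial P Q) (a b c d : α) :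
    (Differ P Q a b c ↔ Differ P Q a b d) ↔ (Differ P Q a c d ↔ Differ P Q b c d) := by
  have s := differ_swap hP hQ
  have r := differ_rot P Q
  have e := not_differ_self P Q
  by_cases hab : a = b
  · subst hab; simp [e]
  by_cases hac : a = c
  · subst hac
    have := (r a a b).not.1 (e a b)
    simp [e, this, s a b d, r b a d]
  by_cases had : a = d
  · subst had
    have h₁ := (r a a b).not.1 (e a b)
    have h₂ := (r a a c).not.1 (e a c)
    simp [h₁, h₂, r a b c]
  by_cases hbc : b = c
  · subst hbc
    rw [r a b b]; simp [e]
  by_cases hbd : b = d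
  · subst hbd
    rw [r a b b, ← r b b c, s a b c]; simp [e]
  by_cases hcd : c = d
  · subst hcd
    rw [r a c c, r b c c]; simp [e]
  have h₁ := four_points hP hQ hr hab hac had hbc hbd hcd
  have h₂ := four_points hP hQ hr had hab hac (Ne.symm hbd) (Ne.symm hcd) hbc
  have h₃ := four_points hP hQ hr (Ne.symm hac) hcd (Ne.symm hbc) had hab (Ne.symm hbd)
  have h₄ := four_points hP hQ hr hbc hbd (Ne.symm hab) hcd (Ne.symm hac) (Ne.symm had)
  have hcda : Differ P Q c d a ↔ Differ P Q a c d := (r a c d).symm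
  have hbda : Differ P Q b d a ↔ Differ P Q a b d := (r a b d).symm
  have hbca : Differ P Q b c a ↔ Differ P Q a b c := (r a b c).symm
  have hcad : Differ P Q c a d ↔ Differ P Q a c d := (r c a d).trans (s a d c)
  have hcdb : Differ P Q c d b ↔ Differ P Q b c d := (r b c d).symm
  simp only [s a d c, s a d b, r d b c, r c a b, hcda, hbda, hbca, hcad, hcdb] at h₁ h₂ h₃ h₄
  clear s r e hcda hbda hbca hcad hcdb
  by_cases A : Differ P Q a b c <;> by_cases B : Differ P Q a b d <;>
    by_cases C : Differ P Q a c d <;> by_cases D : Differ P Q b c d <;> simp_all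

lemma inside_rot (P : α → ℝ × ℝ) (d a b c : α) : Inside P d a b c ↔ Inside P d b c a := by
  unfold Inside; tauto

lemma inside_swap (P : α → ℝ × ℝ) (d a b c : α) : Inside P d a b c ↔ Inside P d a c b := by
  unfold Inside; tauto

lemma area_lt_of_inside (h : Inside P d a b c) : |area P a b d| < |area P a b c| := by
  have := area_add P a b c d
  rcases h with ⟨h₁, h₂, h₃⟩ | ⟨h₁, h₂, h₃⟩ <;> rw [pos_iff] at h₁ h₂ h₃
  · rw [abs_of_pos h₁, abs_of_pos] <;> linarith
  · rw [area_swap_left] at h₁ h₂ h₃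
    rw [abs_of_neg, abs_of_neg] <;> linarith

lemma not_inside_of_inside (h : Inside P d a b c) : ¬ Inside P c a b d :=
  fun h' => lt_asymm (area_lt_of_inside h) (area_lt_of_inside h')

lemma inside_ne (h : Inside P d a b c) : d ≠ a ∧ d ≠ b ∧ d ≠ c := by
  refine ⟨?_, ?_, ?_⟩ <;> rintro rfl <;> simp [Inside, pos_iff, area, det2] at h

lemma mem_convexHull_of_pos (h₁ : Pos P a b d) (h₂ : Pos P b c d) (h₃ : Pos P c a d)
    {s : Set (ℝ × ℝ)} (ha : P a ∈ s) (hb : P b ∈ s) (hc : P c ∈ s) : P d ∈ convexHull ℝ s := by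
  rw [pos_iff] at h₁ h₂ h₃
  have hs := area_add P a b c d
  have h₀ : 0 < area P a b c := by linarith
  have key : P d = ∑ i : Fin 3, ((![area P b c d, area P c a d, area P a b d] i) / area P a b c) •
      (![P a, P b, P c] i) := by
    simp only [Fin.sum_univ_three, Matrix.cons_val]
    ext
    · simp only [Prod.fst_add, Prod.smul_fst, smul_eq_mul]
      field_simp
      simp only [area, det2, Prod.fst_sub, Prod.snd_sub]; ring
    · simp only [Prod.snd_add, Prod.smul_snd, smul_eq_mul]
      field_simp
      simp only [area, det2, Prod.fst_sub, Prod.snd_sub]; ring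
  rw [key]
  refine (convex_convexHull ℝ s).sum_mem ?_ ?_ ?_
  · intro i _
    fin_cases i <;> simp <;> positivity
  · simp only [Fin.sum_univ_three, Matrix.cons_val]
    field_simp
    linarith
  · intro i _
    fin_cases i <;> simp <;> exact subset_convexHull ℝ s (by assumption)

lemma notMem_extremeSet_of_inside (h : Inside P d a b c) : d ∉ ExtremeSet P := by
  obtain ⟨ha, hb, hc⟩ := inside_ne h
  have ha' : P a ∈ P '' {j | j ≠ d} := ⟨a, ha.symm, rfl⟩
  have hb' : P b ∈ P '' {j | j ≠ d} := ⟨b, hb.symm, rfl⟩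
  have hc' : P c ∈ P '' {j | j ≠ d} := ⟨c, hc.symm, rfl⟩
  rcases h with ⟨h₁, h₂, h₃⟩ | ⟨h₁, h₂, h₃⟩
  · exact fun h => h (mem_convexHull_of_pos h₁ h₂ h₃ ha' hb' hc')
  · exact fun h => h (mem_convexHull_of_pos h₁ h₃ h₂ hb' ha' hc')

lemma exists_inside_of_notMem_extremeSet (hi : Function.Injective P) (hP : GenPos P)
    (h : d ∉ ExtremeSet P) : ∃ a b c, Inside P d a b c := by
  simp only [ExtremeSet, Set.mem_ofPred_eq, not_not] at h
  obtain ⟨ι, _, z, w, hz, hai, hw, hsum, hd⟩ := eq_pos_convex_span_of_mem_convexHull h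
  choose f hf using fun i => hz ⟨i, rfl⟩
  have hcard : Fintype.card ι ≤ 3 := by
    have := hai.card_le_finrank_succ
    have h2 : Module.finrank ℝ (vectorSpan ℝ (Set.range z)) ≤ Module.finrank ℝ (ℝ × ℝ) :=
      Submodule.finrank_le _
    simp at h2
    omega
  have hfi : Function.Injective f := fun i j hij =>
    hai.injective (by rw [← (hf i).2, ← (hf j).2, hij])
  obtain ⟨k, hk⟩ : ∃ k, Fintype.card ι = k := ⟨_, rfl⟩
  let e := (Fintype.equivFinOfCardEq hk).symm
  rw [← e.sum_comp] at hsum hd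
  have hfe : ∀ i, z (e i) = P (f (e i)) := fun i => ((hf _).2).symm
  simp only [hfe] at hd
  have hwe : ∀ i, 0 < w (e i) := fun i => hw _
  have hne : ∀ i, f (e i) ≠ d := fun i => (hf _).1
  have hinj : Function.Injective fun i => f (e i) := hfi.comp e.injective
  clear_value e
  obtain ⟨g, hg⟩ : ∃ g : Fin k → α, g = fun i => f (e i) := ⟨_, rfl⟩
  obtain ⟨v, hv⟩ : ∃ v : Fin k → ℝ, v = fun i => w (e i) := ⟨_, rfl⟩
  replace hsum : ∑ i, v i = 1 := by rw [hv]; exact hsum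
  replace hd : ∑ i, v i • P (g i) = P d := by rw [hv, hg]; exact hd
  replace hwe : ∀ i, 0 < v i := by rw [hv]; exact hwe
  replace hne : ∀ i, g i ≠ d := by rw [hg]; exact hne
  replace hinj : Function.Injective g := by rw [hg]; exact hinj
  have hk3 : k ≤ 3 := hk ▸ hcard
  clear hg hv hfe hfi hf hw hai hz hk
  interval_cases k
  · simp at hsum
  · simp only [Fin.sum_univ_one] at hsum hd
    rw [hsum, one_smul] at hd
    exact absurd (hi hd) (hne 0)
  · simp only [Fin.sum_univ_two] at hsum hd
    refine absurd ?_ (area_ne_zero hP (hne 0).symm (hne 1).symm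
      (hinj.ne (by decide : (0 : Fin 2) ≠ 1)))
    simp only [area, det2, ← hd, Prod.fst_sub, Prod.snd_sub, Prod.fst_add, Prod.snd_add,
      Prod.smul_fst, Prod.smul_snd, smul_eq_mul]
    rw [← eq_sub_iff_add_eq] at hsum
    rw [hsum]; ring
  · simp only [Fin.sum_univ_three] at hsum hd
    have h₀ : area P (g 0) (g 1) (g 2) ≠ 0 := area_ne_zero hP (hinj.ne (by decide))
      (hinj.ne (by decide)) (hinj.ne (by decide))
    have hv₀ := eq_sub_iff_add_eq.2 ((add_assoc _ _ _).symm.trans hsum)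
    have h₁ : area P (g 0) (g 1) d = v 2 * area P (g 0) (g 1) (g 2) := by
      simp only [area, det2, ← hd, Prod.fst_sub, Prod.snd_sub, Prod.fst_add, Prod.snd_add,
        Prod.smul_fst, Prod.smul_snd, smul_eq_mul]
      rw [hv₀]; ring
    have h₂ : area P (g 1) (g 2) d = v 0 * area P (g 0) (g 1) (g 2) := by
      simp only [area, det2, ← hd, Prod.fst_sub, Prod.snd_sub, Prod.fst_add, Prod.snd_add,
        Prod.smul_fst, Prod.smul_snd, smul_eq_mul]
      rw [hv₀]; ring
    have h₃ : area P (g 2) (g 0) d = v 1 * area P (g 0) (g 1) (g 2) := by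
      simp only [area, det2, ← hd, Prod.fst_sub, Prod.snd_sub, Prod.fst_add, Prod.snd_add,
        Prod.smul_fst, Prod.smul_snd, smul_eq_mul]
      rw [hv₀]; ring
    refine ⟨g 0, g 1, g 2, ?_⟩
    have w₀ := hwe 0
    have w₁ := hwe 1
    have w₂ := hwe 2
    rcases lt_or_gt_of_ne h₀ with h | h
    · right
      simp only [pos_iff]
      rw [area_swap_left P (g 0) (g 1) d, area_swap_left P (g 1) (g 2) d,
        area_swap_left P (g 2) (g 0) d, h₁, h₂, h₃]
      exact ⟨by nlinarith, by nlinarith, by nlinarith⟩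
    · left
      simp only [pos_iff, h₁, h₂, h₃]
      exact ⟨by positivity, by positivity, by positivity⟩

lemma extremeSet_eq_of_not_differ (hi : Function.Injective P) (hP : GenPos P)
    (hi' : Function.Injective Q) (hQ : GenPos Q) (h : ∀ x y z, ¬ Differ P Q x y z) :
    ExtremeSet P = ExtremeSet Q := by
  have hpos : ∀ x y z, Pos P x y z ↔ Pos Q x y z := fun x y z => not_not.1 (h x y z)
  ext d
  rw [← not_iff_not]
  constructor <;> intro hd
  · obtain ⟨a, b, c, hd⟩ := exists_inside_of_notMem_extremeSet hi hP hd
    exact notMem_extremeSet_of_inside (a := a) (b := b) (c := c) (by simpa [Inside, hpos] using hd)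
  · obtain ⟨a, b, c, hd⟩ := exists_inside_of_notMem_extremeSet hi' hQ hd
    exact notMem_extremeSet_of_inside (a := a) (b := b) (c := c) (by simpa [Inside, hpos] using hd)

/-- If two configurations with the same radial system have distinct triangular extreme sets, then
the extreme triangle is oriented differently in the two configurations. -/
lemma differ_extremeSet [Finite α] (hi : Function.Injective P) (hP : GenPos P)
    (hi' : Function.Injective Q) (hQ : GenPos Q) (hr : SameRadial P Q)
    (hne : ExtremeSet P ≠ ExtremeSet Q) (h : ExtremeSet P = {a, b, c})
    (hc : (ExtremeSet P).ncard = 3) :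
    Differ P Q a b c := by
  have hs := differ_swap hP hQ
  have hro := differ_rot P Q
  have hex : ∃ t : α × α × α, Differ P Q t.1 t.2.1 t.2.2 := by
    by_contra! hcon
    exact hne (extremeSet_eq_of_not_differ hi hP hi' hQ fun x y z => hcon (x, y, z))
  obtain ⟨⟨x, y, z⟩, hD, hmax⟩ := Set.exists_max_image
    {t : α × α × α | Differ P Q t.1 t.2.1 t.2.2} (fun t => |area P t.1 t.2.1 t.2.2|)
    (Set.toFinite _) hex
  simp only [Set.mem_ofPred_eq, Prod.forall] at hD hmax
  have step : ∀ {x' y' z' p : α}, Differ P Q x' y' z' → Differ P Q x' y' p → z' ≠ p →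
      |area P x' y' z'| = |area P x y z| → Inside P p x' y' z' := by
    intro x' y' z' p h₁ h₂ hne hA
    rcases differ_exchange hP hQ hr h₁ h₂ hne with h | h
    · exact h.1
    · have := area_lt_of_inside h.1
      have := hmax _ _ _ h₂
      linarith
  have hin : ∀ p, p ≠ x → p ≠ y → p ≠ z → Inside P p x y z := by
    intro p hx hy hz
    have he := differ_even hP hQ hr x y z p
    by_cases h₁ : Differ P Q x y p
    · exact step hD h₁ hz.symm rfl
    by_cases h₂ : Differ P Q x z p
    · rw [inside_swap]
      exact step ((hs _ _ _).1 hD) h₂ hy.symm (by rw [area_swap, abs_neg])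
    · rw [inside_rot]
      exact step ((hro _ _ _).1 hD) (by simpa [hD, h₁, h₂] using he) hx.symm (by rw [← area_rot])
  have hsub : ExtremeSet P ⊆ {x, y, z} := by
    intro p hp
    by_contra hcon
    simp only [Set.mem_insert_iff, Set.mem_singleton_iff, not_or] at hcon
    exact notMem_extremeSet_of_inside (hin p hcon.1 hcon.2.1 hcon.2.2) hp
  have h3 : ({x, y, z} : Set α).ncard ≤ 3 := by
    obtain ⟨hxy, hxz, hyz⟩ := differ_ne hD
    exact (Set.ncard_eq_three.2 ⟨x, y, z, hxy, hxz, hyz, rfl⟩).le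
  have heq := Set.eq_of_subset_of_ncard_le hsub (by omega)
  rw [h] at heq hc
  have hx : x ∈ ({a, b, c} : Set α) := heq ▸ by simp
  have hy : y ∈ ({a, b, c} : Set α) := heq ▸ by simp
  have hz : z ∈ ({a, b, c} : Set α) := heq ▸ by simp
  obtain ⟨hxy, hxz, hyz⟩ := differ_ne hD
  simp only [Set.mem_insert_iff, Set.mem_singleton_iff] at hx hy hz
  grind

end Orientation

section Classes

variable {α : Type*} {D : α → α → α → Prop} {a b c : α}

open Classical in
/-- A symmetric ternary relation with an even number of triples in every quadruple is complete
tripartite as soon as the vertices of one of its triples have pairwise disjoint links. -/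
lemma exists_classes (hs : ∀ x y z, D x y z ↔ D x z y) (hr : ∀ x y z, D x y z ↔ D y z x)
    (he : ∀ x y, ¬ D x x y)
    (hev : ∀ a b c d, (D a b c ↔ D a b d) ↔ (D a c d ↔ D b c d)) (habc : D a b c)
    (hab : ∀ p q, D a p q → ¬ D b p q) (hac : ∀ p q, D a p q → ¬ D c p q)
    (hbc : ∀ p q, D b p q → ¬ D c p q) :
    ∃ f : α → α, f a = a ∧ f b = b ∧ f c = c ∧ (∀ x, f x = a ∨ f x = b ∨ f x = c) ∧
      ∀ x y z, D x y z ↔ f x ≠ f y ∧ f x ≠ f z ∧ f y ≠ f z := by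
  have nab : a ≠ b := by rintro rfl; exact he _ _ habc
  have nbc : b ≠ c := by rintro rfl; exact he _ _ ((hr _ _ _).1 habc)
  have nac : a ≠ c := by rintro rfl; exact he _ _ ((hr _ _ _).2 habc)
  let f : α → α := fun p => if D b c p then a else if D a c p then b else c
  have hf : ∀ p, f p = a ∨ f p = b ∨ f p = c := by
    intro p; simp only [f]; split_ifs <;> simp
  have h₁ : ∀ p, (D b c p ↔ f p = a) ∧ (D a c p ↔ f p = b) ∧ (D a b p ↔ f p = c) := by
    intro p
    have e := hev a b c p
    have e₁ := hab c p
    have e₂ := hac b p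
    have e₃ := hbc a p
    have s₁ : ∀ x y z, D x y z ↔ D y x z := fun x y z => (hr _ _ _).trans (hs _ _ _)
    rw [s₁ c b p] at e₂
    rw [s₁ b a p, s₁ c a p] at e₃
    simp only [habc, true_iff] at e
    by_cases k₁ : D b c p <;> by_cases k₂ : D a c p <;> by_cases k₃ : D a b p <;>
      simp_all [f, nab.symm, nac.symm, nbc.symm]
  have link : ∀ p q, (D a p q ↔ f p ≠ f q ∧ f p ≠ a ∧ f q ≠ a) ∧
      (D b p q ↔ f p ≠ f q ∧ f p ≠ b ∧ f q ≠ b) ∧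
      (D c p q ↔ f p ≠ f q ∧ f p ≠ c ∧ f q ≠ c) := by
    intro p q
    obtain ⟨p₁, p₂, p₃⟩ := h₁ p
    obtain ⟨q₁, q₂, q₃⟩ := h₁ q
    have e₁ := hev a b p q
    have e₂ := hev a c p q
    have e₃ := hev b c p q
    have e₄ := hab p q
    have e₅ := hac p q
    have e₆ := hbc p q
    rw [p₁, q₁] at e₃
    rw [p₂, q₂] at e₂
    rw [p₃, q₃] at e₁
    clear p₁ p₂ p₃ q₁ q₂ q₃ hs hr he hev hab hac hbc h₁
    rcases hf p with h | h | h <;> rcases hf q with h' | h' | h' <;>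
      simp only [h, h', nab, nac, nbc, nab.symm, nac.symm, nbc.symm, ne_eq, not_true, not_false_iff,
        and_true, and_false, iff_true, iff_false, true_iff, false_iff]
        at e₁ e₂ e₃ ⊢ <;> tauto
  refine ⟨f, ?_, ?_, ?_, hf, ?_⟩
  · exact (h₁ a).1.1 ((hr _ _ _).1 habc)
  · exact (h₁ b).2.1.1 ((hs _ _ _).1 habc)
  · exact (h₁ c).2.2.1 habc
  · intro x y z
    have e := hev a x y z
    rw [(link x y).1, (link x z).1, (link y z).1] at e
    clear hs hr he hev hab hac hbc h₁ link
    rcases hf x with h | h | h <;> rcases hf y with h' | h' | h' <;>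
      rcases hf z with h'' | h'' | h'' <;>
      simp only [h, h', h'', nab, nac, nbc, nab.symm, nac.symm, nbc.symm, ne_eq, not_true,
        not_false_iff, and_true, and_false, iff_true, iff_false, true_iff,
        false_iff, iff_self, not_not] at e ⊢ <;> tauto

/-- If the symmetric difference of two complete tripartite relations `f`, `g` on the same base
triple is complete tripartite, then the class avoiding a point of discrepancy is shared. -/
lemma class_eq_of_xor {f g h : α → α} {u v t a b c w : α}
    (hf : ∀ x, f x = a ∨ f x = b ∨ f x = c) (hg : ∀ x, g x = a ∨ g x = b ∨ g x = c)
    (hh : ∀ x, h x = u ∨ h x = v ∨ h x = t)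
    (nab : a ≠ b) (nac : a ≠ c) (nbc : b ≠ c)
    (fa : f a = a) (fb : f b = b) (fc : f c = c) (ga : g a = a) (gb : g b = b) (gc : g c = c)
    (hx : ∀ x y z, (h x ≠ h y ∧ h x ≠ h z ∧ h y ≠ h z) ↔
      ¬ ((f x ≠ f y ∧ f x ≠ f z ∧ f y ≠ f z) ↔ (g x ≠ g y ∧ g x ≠ g z ∧ g y ≠ g z)))
    (fw : f w = b) (gw : g w = c) (q : α) : f q = a ↔ g q = a := by
  have e₁ := hx a w q
  have e₂ := hx a b q
  have e₃ := hx a c q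
  have e₄ := hx a w c
  have e₅ := hx a w b
  have e₆ := hx b c q
  have e₇ := hx w c q
  have e₈ := hx w b q
  have i₁ := hh a
  have i₂ := hh w
  have i₃ := hh b
  have i₄ := hh c
  have i₅ := hh q
  clear hx hh
  rcases hf q with h | h | h <;> rcases hg q with h' | h' | h' <;>
      simp only [h, h', fa, fb, fc, ga, gb, gc, fw, gw, nab, nac, nbc, nab.symm, nac.symm, nbc.symm,
        ne_eq, not_true, not_false_iff, and_true, and_false, iff_true,
        iff_false, iff_self] at e₁ e₂ e₃ e₄ e₅ e₆ e₇ e₈ ⊢ <;> grind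

end Classes

section Triangles

/-- `P` is a configuration with the radial system of `P₀` and a triangular convex hull. -/
structure IsTriangular {α : Type*} (P₀ P : α → ℝ × ℝ) : Prop where
  injective : Function.Injective P
  genPos : GenPos P
  sameRadial : SameRadial P₀ P
  ncard_eq : (ExtremeSet P).ncard = 3

variable {α : Type*} {P₀ P Q R : α → ℝ × ℝ} {a b c : α}

lemma sameRadial_of_isTriangular (hP : IsTriangular P₀ P) (hQ : IsTriangular P₀ Q) :
    SameRadial P Q :=
  fun i j k l h => (hP.sameRadial i j k l h).symm.trans (hQ.sameRadial i j k l h)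

/-- Extreme points of `P` and of `R` lying in a common class coincide. -/
lemma eq_of_differ (hP : IsTriangular P₀ P) (hQ : IsTriangular P₀ Q) (hR : IsTriangular P₀ R)
    {x y p r : α} (hp : p ∈ ExtremeSet P) (hr : r ∈ ExtremeSet R)
    (h₁ : Differ P Q x y p) (h₂ : Differ P Q x y r) (h₃ : Differ Q R x y p)
    (h₄ : Differ Q R x y r) : p = r := by
  by_contra hne
  rcases differ_exchange hP.genPos hQ.genPos (sameRadial_of_isTriangular hP hQ) h₁ h₂ hne
    with h | h
  · rcases differ_exchange hQ.genPos hR.genPos (sameRadial_of_isTriangular hQ hR) h₃ h₄ hne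
      with h' | h'
    · exact not_inside_of_inside h.2 h'.1
    · exact notMem_extremeSet_of_inside h'.2 hr
  · exact notMem_extremeSet_of_inside h.1 hp

variable [Finite α]

lemma exists_classes_of_isTriangular (hP : IsTriangular P₀ P) (hQ : IsTriangular P₀ Q)
    (hne : ExtremeSet P ≠ ExtremeSet Q) (h : ExtremeSet P = {a, b, c}) :
    ∃ f : α → α, f a = a ∧ f b = b ∧ f c = c ∧ (∀ x, f x = a ∨ f x = b ∨ f x = c) ∧
      ∀ x y z, Differ P Q x y z ↔ f x ≠ f y ∧ f x ≠ f z ∧ f y ≠ f z := by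
  have hr := sameRadial_of_isTriangular hP hQ
  have hD := differ_extremeSet hP.injective hP.genPos hQ.injective hQ.genPos hr hne h hP.ncard_eq
  have hlink : ∀ x y, x ≠ y → x ∈ ExtremeSet P → y ∈ ExtremeSet P → ∀ p q,
      Differ P Q x p q → ¬ Differ P Q y p q := by
    intro x y hxy hx hy p q h₁ h₂
    rw [differ_rot] at h₁ h₂
    rcases differ_exchange hP.genPos hQ.genPos hr h₁ h₂ hxy with h | h
    · exact notMem_extremeSet_of_inside h.1 hy
    · exact notMem_extremeSet_of_inside h.1 hx
  have ha : a ∈ ExtremeSet P := by simp [h]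
  have hb : b ∈ ExtremeSet P := by simp [h]
  have hc : c ∈ ExtremeSet P := by simp [h]
  obtain ⟨hab, hac, hbc⟩ := differ_ne hD
  exact exists_classes (differ_swap hP.genPos hQ.genPos) (differ_rot P Q) (not_differ_self P Q)
    (differ_even hP.genPos hQ.genPos hr) hD (hlink a b hab ha hb) (hlink a c hac ha hc)
    (hlink b c hbc hb hc)

lemma mem_of_class (hP : IsTriangular P₀ P) (hQ : IsTriangular P₀ Q) (hR : IsTriangular P₀ R)
    (hPR : ExtremeSet P ≠ ExtremeSet R) (ha : a ∈ ExtremeSet P) {f g : α → α}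
    (hf : ∀ x y z, Differ P Q x y z ↔ f x ≠ f y ∧ f x ≠ f z ∧ f y ≠ f z)
    (hg : ∀ x y z, Differ P R x y z ↔ g x ≠ g y ∧ g x ≠ g z ∧ g y ≠ g z)
    (hga : ∀ x, g x = a ∨ g x = b ∨ g x = c) (fa : f a = a)
    (hcl : ∀ x, f x = a ↔ g x = a) {x y : α} (hfx : f x ≠ a) (hfy : f y ≠ a) (hxy : f x ≠ f y)
    (hg' : g x = g y) : a ∈ ExtremeSet R := by
  obtain ⟨u, v, t, -, -, -, h⟩ := Set.ncard_eq_three.1 hR.ncard_eq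
  have hD := differ_extremeSet hR.injective hR.genPos hP.injective hP.genPos
    (sameRadial_of_isTriangular hR hP) hPR.symm h hR.ncard_eq
  rw [differ_comm, hg] at hD
  obtain ⟨r, hr, hra⟩ : ∃ r ∈ ExtremeSet R, g r = a := by
    by_contra! hcon
    have h₁ := hcon u (by simp [h])
    have h₂ := hcon v (by simp [h])
    have h₃ := hcon t (by simp [h])
    have := hga u
    have := hga v
    have := hga t
    clear hf hg hga hcl
    grind
  have hfr := (hcl r).2 hra
  have h₁ : Differ P Q x y a := (hf _ _ _).2 ⟨hxy, by rwa [fa], by rwa [fa]⟩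
  have h₂ : Differ P Q x y r := (hf _ _ _).2 ⟨hxy, hfr ▸ hfx, hfr ▸ hfy⟩
  have h₃ : Differ Q R x y a := by
    rw [differ_trans (P := P), hg, iff_true_left h₁]
    exact fun h => h.1 hg'
  have h₄ : Differ Q R x y r := by
    rw [differ_trans (P := P), hg, iff_true_left h₂]
    exact fun h => h.1 hg'
  rw [eq_of_differ hP hQ hR ha hr h₁ h₂ h₃ h₄]
  exact hr

lemma inter_nonempty (hP : IsTriangular P₀ P) (hQ : IsTriangular P₀ Q) (hR : IsTriangular P₀ R)
    (hPQ : ExtremeSet P ≠ ExtremeSet Q) (hPR : ExtremeSet P ≠ ExtremeSet R)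
    (hQR : ExtremeSet Q ≠ ExtremeSet R) :
    ∃ i, i ∈ ExtremeSet P ∧ i ∈ ExtremeSet Q ∧ i ∈ ExtremeSet R := by
  obtain ⟨a, b, c, nab, nac, nbc, h⟩ := Set.ncard_eq_three.1 hP.ncard_eq
  obtain ⟨u, v, t, -, -, -, h'⟩ := Set.ncard_eq_three.1 hQ.ncard_eq
  obtain ⟨f, fa, fb, fc, hf, hfD⟩ := exists_classes_of_isTriangular hP hQ hPQ h
  obtain ⟨g, ga, gb, gc, hg, hgD⟩ := exists_classes_of_isTriangular hP hR hPR h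
  obtain ⟨k, -, -, -, hk, hkD⟩ := exists_classes_of_isTriangular hQ hR hQR h'
  have hx : ∀ x y z, (k x ≠ k y ∧ k x ≠ k z ∧ k y ≠ k z) ↔
      ¬ ((f x ≠ f y ∧ f x ≠ f z ∧ f y ≠ f z) ↔ (g x ≠ g y ∧ g x ≠ g z ∧ g y ≠ g z)) := by
    intro x y z
    rw [← hkD, ← hfD, ← hgD, differ_trans (P := P)]
  have key : ∀ {a b c w : α}, a ≠ b → a ≠ c → b ≠ c → f a = a → f b = b → f c = c → g a = a →
      g b = b → g c = c → (∀ x, f x = a ∨ f x = b ∨ f x = c) →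
      (∀ x, g x = a ∨ g x = b ∨ g x = c) → a ∈ ExtremeSet P → f w = b → g w = c →
      ∃ i, i ∈ ExtremeSet P ∧ i ∈ ExtremeSet Q ∧ i ∈ ExtremeSet R := by
    intro a b c w nab nac nbc fa fb fc ga gb gc hf hg ha fw gw
    have hcl := class_eq_of_xor hf hg hk nab nac nbc fa fb fc ga gb gc hx fw gw
    refine ⟨a, ha, ?_, ?_⟩
    · exact mem_of_class hP hR hQ hPQ ha hgD hfD hf ga (fun x => (hcl x).symm) (x := w) (y := b)
        (by rw [gw]; exact nac.symm) (by rw [gb]; exact nab.symm) (by rw [gw, gb]; exact nbc.symm)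
        (by rw [fw, fb])
    · exact mem_of_class hP hQ hR hPR ha hfD hgD hg fa hcl (x := w) (y := c)
        (by rw [fw]; exact nab.symm) (by rw [fc]; exact nac.symm) (by rw [fw, fc]; exact nbc)
        (by rw [gw, gc])
  obtain ⟨w, hw⟩ : ∃ w, f w ≠ g w := by
    by_contra! hcon
    have hD := differ_extremeSet hQ.injective hQ.genPos hR.injective hR.genPos
      (sameRadial_of_isTriangular hQ hR) hQR h' hQ.ncard_eq
    rw [differ_trans (P := P), hfD, hgD] at hD
    simp [hcon] at hD
  have ha : a ∈ ExtremeSet P := by simp [h]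
  have hb : b ∈ ExtremeSet P := by simp [h]
  have hc : c ∈ ExtremeSet P := by simp [h]
  rcases hf w with h₁ | h₁ | h₁ <;> rcases hg w with h₂ | h₂ | h₂
  · exact absurd (h₁.trans h₂.symm) hw
  · exact key nac.symm nbc.symm nab fc fa fb gc ga gb (by grind) (by grind) hc h₁ h₂
  · exact key nab.symm nbc nac fb fa fc gb ga gc (by grind) (by grind) hb h₁ h₂
  · exact key nbc.symm nac.symm nab.symm fc fb fa gc gb ga (by grind) (by grind) hc h₁ h₂
  · exact absurd (h₁.trans h₂.symm) hw
  · exact key nab nac nbc fa fb fc ga gb gc hf hg ha h₁ h₂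
  · exact key nbc nab.symm nac.symm fb fc fa gb gc ga (by grind) (by grind) hb h₁ h₂
  · exact key nac nab nbc.symm fa fc fb ga gc gb (by grind) (by grind) ha h₁ h₂
  · exact absurd (h₁.trans h₂.symm) hw

/-- If two extreme triangles share the edge `a b`, then exactly the triples containing `a` and `b`
change their orientation. -/
lemma differ_of_common_edge (hP : IsTriangular P₀ P) (hQ : IsTriangular P₀ Q) {d p q : α}
    (hcd : c ≠ d) (hbd : b ≠ d) (had : a ≠ d) (h : ExtremeSet P = {a, b, c})
    (h' : ExtremeSet Q = {a, b, d}) (hpa : p ≠ a) (hpb : p ≠ b) (hqa : q ≠ a) (hqb : q ≠ b) :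
    Differ P Q a b p ∧ ¬ Differ P Q a p q := by
  have hne : ExtremeSet P ≠ ExtremeSet Q := by
    intro heq
    have hd : d ∈ ExtremeSet P := by rw [heq, h']; simp
    rw [h] at hd
    simp [hcd.symm, hbd.symm, had.symm] at hd
  obtain ⟨f, fa, fb, fc, hf, hD⟩ := exists_classes_of_isTriangular hP hQ hne h
  have habc := (hD _ _ _).1
    (differ_extremeSet hP.injective hP.genPos hQ.injective hQ.genPos
      (sameRadial_of_isTriangular hP hQ) hne h hP.ncard_eq)
  rw [fa, fb, fc] at habc
  obtain ⟨hab, hac, hbc⟩ := habc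
  have common : ∀ {x y z r : α}, x ∈ ExtremeSet P → x ∈ ExtremeSet Q → r ≠ x →
      Differ P Q y z x → ¬ Differ P Q y z r := by
    intro x y z r hx hx' hr h₁ h₂
    rcases differ_exchange hP.genPos hQ.genPos (sameRadial_of_isTriangular hP hQ) h₁ h₂ hr.symm
      with h | h
    · exact notMem_extremeSet_of_inside h.2 hx'
    · exact notMem_extremeSet_of_inside h.1 hx
  have hfc : ∀ r, r ≠ a → r ≠ b → f r = c := by
    intro r hra hrb
    rcases hf r with hr | hr | hr
    · refine absurd ?_ (common (x := a) (y := b) (z := c) (by simp [h]) (by simp [h']) hra ?_) <;>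
        rw [hD] <;> simp [hr, fa, fb, fc, hab.symm, hac.symm, hbc]
    · refine absurd ?_ (common (x := b) (y := a) (z := c) (by simp [h]) (by simp [h']) hrb ?_) <;>
        rw [hD] <;> simp [hr, fa, fb, fc, hab, hac, hbc.symm]
    · exact hr
  rw [hD, hD, hfc p hpa hpb, hfc q hqa hqb, fa, fb]
  exact ⟨⟨hab, hac, hbc⟩, fun h => h.2.2 rfl⟩

/-- Three important triangles cannot lie on four of at least five indices. -/
lemma not_three_in_four (hP : IsTriangular P₀ P) (hQ : IsTriangular P₀ Q)
    (hR : IsTriangular P₀ R) {d e : α} (hac : a ≠ c) (had : a ≠ d) (hbc : b ≠ c)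
    (hbd : b ≠ d) (hcd : c ≠ d) (hea : e ≠ a) (heb : e ≠ b) (hec : e ≠ c) (hed : e ≠ d)
    (h₁ : ExtremeSet P = {a, b, c}) (h₂ : ExtremeSet Q = {a, b, d})
    (h₃ : ExtremeSet R = {a, c, d}) : False := by
  have k₁ := (differ_of_common_edge hP hQ hcd hbd had h₁ h₂ had.symm hbd.symm hea heb).2
  have k₂ := (differ_of_common_edge hP hR hbd hcd had (by rw [h₁, Set.pair_comm b c]) h₃ had.symm
    hcd.symm hea hec).2
  have k₃ := (differ_of_common_edge hQ hR hbc hcd.symm hac (by rw [h₂, Set.pair_comm b d])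
    (by rw [h₃, Set.pair_comm c d]) hea hed hea hed).1
  rw [differ_trans (P := P)] at k₃
  exact k₃ (iff_of_false k₁ k₂)

end Triangles


section CommonElement

variable {α : Type*}

lemma eq_triple_of_ncard {H : Set α} (hH : H.ncard = 3) {x y z : α} (hx : x ∈ H) (hy : y ∈ H)
    (hz : z ∈ H) (hxy : x ≠ y) (hxz : x ≠ z) (hyz : y ≠ z) : H = {x, y, z} := by
  have hs : ({x, y, z} : Set α) ⊆ H := by
    rintro w (rfl | rfl | rfl) <;> assumption
  refine (Set.eq_of_subset_of_ncard_le hs ?_ (Set.finite_of_ncard_ne_zero (by omega))).symm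
  rw [hH, Set.ncard_eq_three.2 ⟨x, y, z, hxy, hxz, hyz, rfl⟩]

/-- A family of triples, any three of which meet and no three of which lie in four points as
`{a, b, c}`, `{a, b, d}`, `{a, c, d}`, has a common element once it has three members. -/
lemma exists_common_element {F : Set (Set α)} (hcard : ∀ H ∈ F, H.ncard = 3)
    (meet : ∀ H ∈ F, ∀ K ∈ F, ∀ L ∈ F, H ≠ K → H ≠ L → K ≠ L → ∃ i, i ∈ H ∧ i ∈ K ∧ i ∈ L)
    (four : ∀ a b c d : α, a ≠ b → a ≠ c → a ≠ d → b ≠ c → b ≠ d → c ≠ d →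
      {a, b, c} ∈ F → {a, b, d} ∈ F → {a, c, d} ∈ F → False)
    {H₁ H₂ H₃ : Set α} (h₁ : H₁ ∈ F) (h₂ : H₂ ∈ F) (h₃ : H₃ ∈ F)
    (h₁₂ : H₁ ≠ H₂) (h₁₃ : H₁ ≠ H₃) (h₂₃ : H₂ ≠ H₃) : ∃ i, ∀ H ∈ F, i ∈ H := by
  by_contra! hcon
  obtain ⟨v, v₁, v₂, v₃⟩ := meet _ h₁ _ h₂ _ h₃ h₁₂ h₁₃ h₂₃
  obtain ⟨H₄, h₄, v₄⟩ := hcon v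
  have ne_of : ∀ {x : α} {H K : Set α}, x ∈ H → x ∉ K → H ≠ K := by
    rintro x H _ hx hx' rfl
    exact hx' hx
  obtain ⟨w, w₁, w₂, w₄⟩ := meet _ h₁ _ h₂ _ h₄ h₁₂ (ne_of v₁ v₄) (ne_of v₂ v₄)
  obtain ⟨u, u₁, u₃, u₄⟩ := meet _ h₁ _ h₃ _ h₄ h₁₃ (ne_of v₁ v₄) (ne_of v₃ v₄)
  obtain ⟨t, t₂, t₃, t₄⟩ := meet _ h₂ _ h₃ _ h₄ h₂₃ (ne_of v₂ v₄) (ne_of v₃ v₄)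
  have hv : ∀ {x}, x ∈ H₄ → v ≠ x := by
    rintro x hx rfl
    exact v₄ hx
  have third : ∀ {z}, z ∈ H₁ → z ∈ H₂ → z ∈ H₃ → z ∈ H₄ → False := by
    intro z z₁ z₂ z₃ z₄
    obtain ⟨H₅, h₅, z₅⟩ := hcon z
    have v₅ : v ∈ H₅ := by
      by_contra v₅
      obtain ⟨p, p₁, p₂, p₅⟩ := meet _ h₁ _ h₂ _ h₅ h₁₂ (ne_of z₁ z₅) (ne_of z₂ z₅)
      have hp : v ≠ p := by rintro rfl; exact v₅ p₅
      have hp' : z ≠ p := by rintro rfl; exact z₅ p₅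
      exact h₁₂ ((eq_triple_of_ncard (hcard _ h₁) v₁ z₁ p₁ (hv z₄) hp hp').trans
        (eq_triple_of_ncard (hcard _ h₂) v₂ z₂ p₂ (hv z₄) hp hp').symm)
    have extra : ∀ H ∈ F, v ∈ H → z ∈ H → ∃ x ∈ H₄, z ≠ x ∧ H = {v, z, x} := by
      intro H h hvH hzH
      obtain ⟨x, hx, hx₄, hx₅⟩ := meet _ h _ h₄ _ h₅ (ne_of hvH v₄) (ne_of hzH z₅)
        (ne_of z₄ z₅)
      have hzx : z ≠ x := by rintro rfl; exact z₅ hx₅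
      exact ⟨x, hx₄, hzx, eq_triple_of_ncard (hcard _ h) hvH hzH hx (hv z₄) (hv hx₄) hzx⟩
    obtain ⟨x, x₄, hzx, ex⟩ := extra _ h₁ v₁ z₁
    obtain ⟨y, y₄, hzy, ey⟩ := extra _ h₂ v₂ z₂
    obtain ⟨r, r₄, hzr, er⟩ := extra _ h₃ v₃ z₃
    have hxy : x ≠ y := by rintro rfl; exact h₁₂ (ex.trans ey.symm)
    have hxr : x ≠ r := by rintro rfl; exact h₁₃ (ex.trans er.symm)
    have hyr : y ≠ r := by rintro rfl; exact h₂₃ (ey.trans er.symm)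
    have e := eq_triple_of_ncard (hcard _ h₄) z₄ x₄ y₄ hzx hzy hxy
    rw [e] at r₄
    rcases r₄ with h | h | h
    exacts [hzr h.symm, hxr h.symm, hyr h.symm]
  have hwu : w ≠ u := by rintro rfl; exact third w₁ w₂ u₃ w₄
  have hwt : w ≠ t := by rintro rfl; exact third w₁ w₂ t₃ w₄
  have hut : u ≠ t := by rintro rfl; exact third u₁ t₂ u₃ u₄
  refine four v w u t (hv w₄) (hv u₄) (hv t₄) hwu hwt hut ?_ ?_ ?_
  · rwa [← eq_triple_of_ncard (hcard _ h₁) v₁ w₁ u₁ (hv w₄) (hv u₄) hwu]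
  · rwa [← eq_triple_of_ncard (hcard _ h₂) v₂ w₂ t₂ (hv w₄) (hv t₄) hwt]
  · rwa [← eq_triple_of_ncard (hcard _ h₃) v₃ u₃ t₃ (hv u₄) (hv t₄) hut]

end CommonElement

/-- if there are at least three pairwise distinct important
triangles, then some index belongs to every important triangle. -/
theorem important_triangles_common_vertex {n : ℕ} (hn : 5 ≤ n)
    (P₀ : Fin n → ℝ × ℝ)
    (hinj : Function.Injective P₀) (hgp : GenPos P₀)
    (H₁ H₂ H₃ : Set (Fin n))
    (h₁ : Important P₀ H₁) (h₂ : Important P₀ H₂) (h₃ : Important P₀ H₃)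
    (h₁₂ : H₁ ≠ H₂) (h₁₃ : H₁ ≠ H₃) (h₂₃ : H₂ ≠ H₃)
    (hc₁ : H₁.ncard = 3) (hc₂ : H₂.ncard = 3) (hc₃ : H₃.ncard = 3) :
    ∃ i : Fin n, ∀ H : Set (Fin n), Important P₀ H → H.ncard = 3 → i ∈ H := by
  have tri : ∀ H, Important P₀ H → H.ncard = 3 → ∃ P, IsTriangular P₀ P ∧ ExtremeSet P = H := by
    rintro H ⟨P, hi, hg, hr, rfl⟩ hc
    exact ⟨P, ⟨hi, hg, hr, hc⟩, rfl⟩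
  have meet : ∀ H K L, Important P₀ H → H.ncard = 3 → Important P₀ K → K.ncard = 3 →
      Important P₀ L → L.ncard = 3 → H ≠ K → H ≠ L → K ≠ L → ∃ i, i ∈ H ∧ i ∈ K ∧ i ∈ L := by
    intro H K L hH hH' hK hK' hL hL' hHK hHL hKL
    obtain ⟨P, hP, rfl⟩ := tri H hH hH'
    obtain ⟨Q, hQ, rfl⟩ := tri K hK hK'
    obtain ⟨R, hR, rfl⟩ := tri L hL hL'
    exact inter_nonempty hP hQ hR hHK hHL hKL
  have four : ∀ a b c d : Fin n, a ≠ b → a ≠ c → a ≠ d → b ≠ c → b ≠ d → c ≠ d →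
      Important P₀ {a, b, c} → Important P₀ {a, b, d} → Important P₀ {a, c, d} → False := by
    intro a b c d hab hac had hbc hbd hcd hH hK hL
    obtain ⟨e, he⟩ : ∃ e, e ∉ ({a, b, c, d} : Finset (Fin n)) := by
      by_contra! hcon
      have := Finset.card_le_card (fun x _ => hcon x :
        Finset.univ ⊆ ({a, b, c, d} : Finset (Fin n)))
      have := Finset.card_le_four (a := a) (b := b) (c := c) (d := d)
      simp only [Finset.card_univ, Fintype.card_fin] at *
      omega
    simp only [Finset.mem_insert, Finset.mem_singleton, not_or] at he
    obtain ⟨P, hP, hP'⟩ := tri _ hH (Set.ncard_eq_three.2 ⟨a, b, c, hab, hac, hbc, rfl⟩)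
    obtain ⟨Q, hQ, hQ'⟩ := tri _ hK (Set.ncard_eq_three.2 ⟨a, b, d, hab, had, hbd, rfl⟩)
    obtain ⟨R, hR, hR'⟩ := tri _ hL (Set.ncard_eq_three.2 ⟨a, c, d, hac, had, hcd, rfl⟩)
    exact not_three_in_four hP hQ hR hac had hbc hbd hcd he.1 he.2.1 he.2.2.1 he.2.2.2
      hP' hQ' hR'
  obtain ⟨i, hi⟩ := exists_common_element (F := {H | Important P₀ H ∧ H.ncard = 3})
    (fun H hH => hH.2)
    (fun H hH K hK L hL => meet H K L hH.1 hH.2 hK.1 hK.2 hL.1 hL.2)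
    (fun a b c d hab hac had hbc hbd hcd hH hK hL =>
      four a b c d hab hac had hbc hbd hcd hH.1 hK.1 hL.1)
    ⟨h₁, hc₁⟩ ⟨h₂, hc₂⟩ ⟨h₃, hc₃⟩ h₁₂ h₁₃ h₂₃
  exact ⟨i, fun H hH hH' => hi H ⟨hH, hH'⟩⟩
end
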